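/- If E is a nonzero coherent sheaf on P^m, then for each integer d there exists some i with h^i(E(d−i)) ≠ 0; moreover, the functions d ↦ M_d := max{ i : h^i(E(d−i)) ≠ 0 } and d ↦ m_d := min{ i : h^i(E(d−i)) ≠ 0 } are weakly decreasing functions of d. -/

import Mathlib

open MvPolynomial Finset Module

noncomputable section

/-- The standard graded polynomial ring `S = K[x_1, …, x_n]`. -/
abbrev PolyS (K : Type) [Field K] (n : ℕ) : Type := MvPolynomial (Fin n) K

/-- The `K`-subspace of homogeneous polynomials of integer degree `z`
(it is `0` if `z < 0`). -/
def homogZ (K : Type) [Field K] (n : ℕ) (z : ℤ) : Submodule K (PolyS K n) :=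
  ⨆ (_ : 0 ≤ z), MvPolynomial.homogeneousSubmodule (Fin n) K z.toNat

/-- The degree-`ℓ` piece of the graded free module `⊕ₚ S(-dg p)`. -/
def freePiece {K : Type} [Field K] {n r : ℕ} (dg : Fin r → ℤ) (ℓ : ℤ) :
    Submodule K (Fin r → PolyS K n) :=
  Submodule.pi Set.univ fun p => homogZ K n (ℓ - dg p)

/-- A (homologically indexed) finite complex of graded free `S`-modules
`F₀ ← F₁ ← ⋯ ← F_len ← 0`, where `Fᵢ = ⊕ₚ S(-deg i p)` and the (degree `0`)
map `Fᵢ₊₁ → Fᵢ` is given by the matrix `dd i`, whose entries are homogeneous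
of the appropriate degrees. -/
structure FreeComplex (K : Type) [Field K] (n : ℕ) where
  len : ℕ
  rk : ℕ → ℕ
  deg : (i : ℕ) → Fin (rk i) → ℤ
  dd : (i : ℕ) → Matrix (Fin (rk i)) (Fin (rk (i+1))) (PolyS K n)
  rk_eq_zero : ∀ i, len < i → rk i = 0
  isHomog : ∀ i p q, dd i p q ∈ homogZ K n (deg (i+1) q - deg i p)
  isComplex : ∀ i, dd i * dd (i+1) = 0

variable {K : Type} [Field K] {n : ℕ}

/-- `F` is exact in positive homological degrees; that is, it is a graded free
resolution of the finitely generated graded module `M = coker (F₁ → F₀)`. -/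
def IsResolution (F : FreeComplex K n) : Prop :=
  ∀ i, LinearMap.ker ((F.dd i).mulVecLin) = LinearMap.range ((F.dd (i+1)).mulVecLin)

/-- The complex is minimal: entries of the differentials lie in the maximal ideal,
i.e. all (constant) entries between generators of equal degrees vanish. -/
def IsMinimal (F : FreeComplex K n) : Prop :=
  ∀ i p q, F.deg (i+1) q = F.deg i p → F.dd i p q = 0

/-- Betti number `β_{i,j}`: the number of generators of `Fᵢ` of degree `j`. -/
def bettiNum (F : FreeComplex K n) (i : ℕ) (j : ℤ) : ℕ :=
  (Finset.univ.filter fun p => F.deg i p = j).card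

/-- The dimension of the degree-`ℓ` piece of the module `M = coker (F₁ → F₀)`
resolved by `F`. -/
def MPieceDim (F : FreeComplex K n) (ℓ : ℤ) : ℕ :=
  finrank K ((freePiece (F.deg 0) ℓ) ⧸
    (Submodule.comap (freePiece (F.deg 0) ℓ).subtype
      ((LinearMap.range ((F.dd 0).mulVecLin)).restrictScalars K)))

/-- The Hilbert polynomial of the twisted free module `S(-a)` in `n` variables:
`binom (t - a + n - 1, n - 1)`. -/
def genHilb (n : ℕ) (a : ℤ) : Polynomial ℚ :=
  if n = 0 then 0 else
    Polynomial.C (((n - 1).factorial : ℚ))⁻¹ *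
      ∏ k ∈ Finset.range (n - 1),
        (Polynomial.X - Polynomial.C (a : ℚ) + Polynomial.C ((k : ℚ) + 1))

/-- The Hilbert polynomial of `M = coker (F₁ → F₀)`, computed from the free
resolution `F` by additivity. -/
def hilbPoly (F : FreeComplex K n) : Polynomial ℚ :=
  ∑ i ∈ Finset.range (F.len + 1),
    Polynomial.C ((-1 : ℚ) ^ i) * ∑ p : Fin (F.rk i), genHilb n (F.deg i p)

/-- The Krull dimension of a module read off from its Hilbert polynomial:
`0` for the zero polynomial (finite length), `deg + 1` otherwise. -/
def polyDim (P : Polynomial ℚ) : ℕ := if P = 0 then 0 else P.natDegree + 1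

/-- `M = coker (F₁ → F₀)` is a Cohen-Macaulay module of codimension `c`:
`F` is a minimal free resolution of length exactly `c` (so `pd M = c`, and by
Auslander–Buchsbaum `depth M = n - c`) and `dim M = n - c`. -/
def IsCMcodim (F : FreeComplex K n) (c : ℕ) : Prop :=
  IsResolution F ∧ IsMinimal F ∧ (∀ i, c < i → F.rk i = 0) ∧ F.rk c ≠ 0 ∧
    polyDim (hilbPoly F) = n - c

/-- The multiplicity `e(M)` of a module of codimension `c`, computed from the
Betti numbers of a free resolution:
`e(M) = ((-1)^c / c!) ⬝ Σ_{i,j} (-1)^i β_{i,j} j^c`. -/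
def multQ (F : FreeComplex K n) (c : ℕ) : ℚ :=
  ((-1 : ℚ) ^ c / c.factorial) *
    ∑ i ∈ Finset.range (F.len + 1),
      (-1 : ℚ) ^ i * ∑ p : Fin (F.rk i), ((F.deg i p : ℚ)) ^ c


/-- A (cohomologically indexed) finite complex of graded free `S`-modules
`0 → E⁰ → E¹ → ⋯ → E^len → 0`, where `Eⁱ = ⊕ₚ S(-deg i p)` and the (degree `0`)
map `Eⁱ → Eⁱ⁺¹` is given by the matrix `dd i`. -/
structure CoComplex (K : Type) [Field K] (n : ℕ) where
  len : ℕ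
  rk : ℕ → ℕ
  deg : (i : ℕ) → Fin (rk i) → ℤ
  dd : (i : ℕ) → Matrix (Fin (rk (i+1))) (Fin (rk i)) (PolyS K n)
  rk_eq_zero : ∀ i, len < i → rk i = 0
  isHomog : ∀ i p q, dd i p q ∈ homogZ K n (deg i q - deg (i+1) p)
  isComplex : ∀ i, dd (i+1) * dd i = 0

/-- The degree-`ℓ` part of the cocycles at cohomological position `i`. -/
def CoComplex.kerPiece (E : CoComplex K n) (i : ℕ) (ℓ : ℤ) :
    Submodule K (Fin (E.rk i) → PolyS K n) :=
  ((LinearMap.ker ((E.dd i).mulVecLin)).restrictScalars K) ⊓ freePiece (E.deg i) ℓ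

/-- The coboundaries at cohomological position `i` (as a `K`-subspace). -/
def CoComplex.imSub (E : CoComplex K n) : (i : ℕ) → Submodule K (Fin (E.rk i) → PolyS K n)
  | 0 => ⊥
  | (j+1) => (LinearMap.range ((E.dd j).mulVecLin)).restrictScalars K

/-- `dim_K (Hⁱ(E))_ℓ`, the dimension of the degree-`ℓ` component of the `i`-th
cohomology module of the complex `E`. -/
def cohomDim (E : CoComplex K n) (i : ℕ) (ℓ : ℤ) : ℕ :=
  finrank K ((E.kerPiece i ℓ) ⧸
    (Submodule.comap (E.kerPiece i ℓ).subtype (E.imSub i)))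

/-- The bilinear pairing `⟨F, E⟩ = Σ_{j ≤ i, k} (-1)^{i-j} β_{i,k}(F) ⬝ dim_K (H^j E)_{-k}`
of a free resolution `F` against a free cocomplex `E`. -/
def pairing (F : FreeComplex K n) (E : CoComplex K n) : ℤ :=
  ∑ i ∈ Finset.range (F.len + 1), ∑ j ∈ Finset.range (i + 1),
    (-1 : ℤ) ^ (i - j) * ∑ p : Fin (F.rk i), (cohomDim E j (-(F.deg i p)) : ℤ)

/-- The modified pairing `⟨F, E⟩_{c,τ}`: terms with `j ≤ i` are kept when `j < τ`
or `j ≤ i - 2`, and the terms with `j = τ`, `i = τ + ε` (`ε ∈ {0,1}`) are kept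
only when the degree `k` of the generator satisfies `k ≤ c + ε`. -/
def pairingMod (F : FreeComplex K n) (E : CoComplex K n) (c : ℤ) (τ : ℕ) : ℤ :=
  (∑ i ∈ Finset.range (F.len + 1), ∑ j ∈ Finset.range (i + 1),
    if j < τ ∨ j + 2 ≤ i then
      (-1 : ℤ) ^ (i - j) * ∑ p : Fin (F.rk i), (cohomDim E j (-(F.deg i p)) : ℤ)
    else 0) +
  ∑ ε ∈ Finset.range 2,
    (-1 : ℤ) ^ ε * ∑ p ∈ Finset.univ.filter (fun p => F.deg (τ + ε) p ≤ c + ε),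
      (cohomDim E τ (-(F.deg (τ + ε) p)) : ℤ)

/-- The dual cocomplex `Hom(F, S)`: `0 → F₀^∨ → F₁^∨ → ⋯`. Its `j`-th cohomology
is `Ext^j_S(M, S)` for the module `M` resolved by `F`. -/
def dualCo (F : FreeComplex K n) : CoComplex K n where
  len := F.len
  rk := F.rk
  deg := fun i p => -F.deg i p
  dd := fun i => (F.dd i).transpose
  rk_eq_zero := F.rk_eq_zero
  isHomog := by
    intro i p q
    have h := F.isHomog i q p
    rw [neg_sub_neg]
    exact h
  isComplex := by
    intro i
    rw [← Matrix.transpose_mul, F.isComplex i, Matrix.transpose_zero]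

/-- `dim_K Ext^j_S(M, S)_e`, where `M = coker (F₁ → F₀)` (zero for `j < 0`). -/
def extDim (F : FreeComplex K n) (j : ℤ) (e : ℤ) : ℕ :=
  if 0 ≤ j then cohomDim (dualCo F) j.toNat e else 0

/-- `h^i(𝓔(d)) = dim_K H^i(ℙ^{n-1}, 𝓔(d))` for the coherent sheaf `𝓔 = M~` on
`ℙ^{n-1}` associated to the module `M = coker (F₁ → F₀)` resolved by `F`,
expressed via graded local duality:
`h^i(𝓔(d)) = dim Ext^{n-1-i}(M,S)_{-d-n}` for `i ≥ 1`, and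
`h^0(𝓔(d)) = dim M_d - dim Ext^{n}(M,S)_{-d-n} + dim Ext^{n-1}(M,S)_{-d-n}`. -/
def sheafH (F : FreeComplex K n) (i : ℕ) (d : ℤ) : ℕ :=
  if i = 0 then
    MPieceDim F d - extDim F (n : ℤ) (-d - n) + extDim F ((n : ℤ) - 1) (-d - n)
  else extDim F ((n : ℤ) - 1 - i) (-d - n)

/-- The ideal generated by the `s × s` minors of a matrix. -/
def minorsIdeal {a b : ℕ} (M : Matrix (Fin a) (Fin b) (PolyS K n)) (s : ℕ) :
    Ideal (PolyS K n) :=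
  Ideal.span (Set.range fun fg : (Fin s ↪ Fin a) × (Fin s ↪ Fin b) =>
    (M.submatrix fg.1 fg.2).det)

/-- The `r`-th Fitting ideal of `M = coker (F₁ → F₀)`: the ideal of
`(rk F₀ - r)`-minors of the presentation matrix. -/
def fittingIdeal (F : FreeComplex K n) (r : ℤ) : Ideal (PolyS K n) :=
  if (F.rk 0 : ℤ) - r ≤ 0 then ⊤ else minorsIdeal (F.dd 0) ((F.rk 0 : ℤ) - r).toNat

/-- The irrelevant maximal ideal `(x_1, …, x_n)` of `S`. -/
def irrel (K : Type) [Field K] (n : ℕ) : Ideal (PolyS K n) :=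
  Ideal.span (Set.range (MvPolynomial.X : Fin n → PolyS K n))

/-- The coherent sheaf `M~` on `ℙ^{n-1}` associated to `M = coker (F₁ → F₀)` is a
locally free sheaf (vector bundle) of rank `r`: the Fitting ideal `Fitt_{r-1}(M)`
is zero and `Fitt_r(M)` contains a power of the irrelevant ideal. -/
def IsVectorBundle (F : FreeComplex K n) (r : ℕ) : Prop :=
  fittingIdeal F ((r : ℤ) - 1) = ⊥ ∧ ∃ N : ℕ, (irrel K n) ^ N ≤ fittingIdeal F r

/-- The rank of a sheaf of dimension `s`: the normalized leading coefficient of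
its Hilbert polynomial, `χ(𝓔(d)) = (rank 𝓔 / s!) d^s + O(d^{s-1})`. -/
def sheafRank (F : FreeComplex K n) (s : ℕ) : ℚ :=
  (s.factorial : ℚ) * (hilbPoly F).coeff s

/-- The sheaf `M~` has natural cohomology: for each `d` at most one `h^i(𝓔(d))`
is nonzero. -/
def HasNaturalCohomology (F : FreeComplex K n) : Prop :=
  ∀ (d : ℤ) (i i' : ℕ), sheafH F i d ≠ 0 → sheafH F i' d ≠ 0 → i = i'

/-- The sheaf `𝓔 = M~` (of dimension `s`) has supernatural cohomology with root
sequence `z_1 > ⋯ > z_s`: it has natural cohomology and its Hilbert polynomial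
`d ↦ χ(𝓔(d))` has the distinct integral roots `z_1 > ⋯ > z_s`. -/
def IsSupernaturalWithRoots (F : FreeComplex K n) {s : ℕ} (z : Fin s → ℤ) : Prop :=
  StrictAnti z ∧ HasNaturalCohomology F ∧
    ∃ a : ℚ, a ≠ 0 ∧
      hilbPoly F = Polynomial.C a * ∏ i : Fin s, (Polynomial.X - Polynomial.C ((z i : ℚ)))


set_option linter.unusedVariables false
open MvPolynomial Finset Module

/-! ### Part 1: graded complexes with commuting operators -/

/-- A bigraded complex with commuting operators `x i` of internal degree one. -/
structure GC (K : Type) [Field K] (n : ℕ) where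
  V : Type
  [ag : AddCommGroup V]
  [mo : Module K V]
  gr : ℤ → ℤ → Submodule K V
  d : V →ₗ[K] V
  x : Fin n → V →ₗ[K] V
  d_mem : ∀ q a v, v ∈ gr q a → d v ∈ gr (q + 1) a
  x_mem : ∀ i q a v, v ∈ gr q a → x i v ∈ gr q (a + 1)
  dd : ∀ q a v, v ∈ gr q a → d (d v) = 0
  dx : ∀ i v, d (x i v) = x i (d v)
  xx : ∀ i j v, x i (x j v) = x j (x i v)

attribute [instance] GC.ag GC.mo

/-- Exactness in bidegree `(q, a)`. -/
def GC.Ex (X : GC K n) (q a : ℤ) : Prop :=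
  ∀ v ∈ X.gr q a, X.d v = 0 → ∃ u ∈ X.gr (q - 1) a, X.d u = v

/-- The mapping cone of the operator `x i`. -/
def GC.cone (X : GC K n) (i : Fin n) : GC K n where
  V := X.V × X.V
  gr q a := (X.gr (q + 1) a).prod (X.gr q (a + 1))
  d := LinearMap.prod (-(X.d ∘ₗ LinearMap.fst K _ _))
    (X.x i ∘ₗ LinearMap.fst K _ _ + X.d ∘ₗ LinearMap.snd K _ _)
  x j := LinearMap.prodMap (X.x j) (X.x j)
  d_mem := by
    rintro q a ⟨u, v⟩ ⟨hu, hv⟩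
    refine ⟨?_, ?_⟩
    · simpa using X.d_mem _ _ _ hu
    · simpa using add_mem (X.x_mem i _ _ _ hu) (X.d_mem _ _ _ hv)
  x_mem := by
    rintro j q a ⟨u, v⟩ ⟨hu, hv⟩
    exact ⟨X.x_mem j _ _ _ hu, X.x_mem j _ _ _ hv⟩
  dd := by
    rintro q a ⟨u, v⟩ ⟨hu, hv⟩
    have h1 := X.dd _ _ _ hu
    have h2 := X.dd _ _ _ hv
    simp at h1 h2
    simp [h1, h2, X.dx]
  dx := by
    rintro j ⟨u, v⟩
    simp [X.dx, X.xx i j]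
  xx := by
    rintro i j ⟨u, v⟩
    simp [X.xx i j]

theorem GC.cone_Ex_iff {X : GC K n} {i : Fin n} {q a : ℤ} : (X.cone i).Ex q a ↔
    ∀ u ∈ X.gr (q + 1) a, ∀ v ∈ X.gr q (a + 1), X.d u = 0 → X.x i u + X.d v = 0 →
      ∃ s ∈ X.gr q a, ∃ t ∈ X.gr (q - 1) (a + 1), -X.d s = u ∧ X.x i s + X.d t = v := by
  constructor
  · intro h u hu v hv h1 h2
    obtain ⟨⟨s, t⟩, ⟨hs, ht⟩, e⟩ := h (u, v) ⟨hu, hv⟩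
      (Prod.ext (show -X.d u = 0 by rw [h1, neg_zero]) h2)
    exact ⟨s, by simpa using hs, t, ht, congrArg Prod.fst e, congrArg Prod.snd e⟩
  · rintro h ⟨u, v⟩ ⟨hu, hv⟩ e
    have e1 : -X.d u = 0 := congrArg Prod.fst e
    obtain ⟨s, hs, t, ht, e2, e3⟩ := h u hu v hv (neg_eq_zero.1 e1) (congrArg Prod.snd e)
    exact ⟨(s, t), ⟨by simpa using hs, ht⟩, Prod.ext e2 e3⟩

theorem GC.cone_ex {X : GC K n} {i : Fin n} {q a : ℤ} (h1 : X.Ex q (a + 1))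
    (h2 : X.Ex (q + 1) a) : (X.cone i).Ex q a := by
  rw [GC.cone_Ex_iff]
  intro u hu v hv e1 e2
  obtain ⟨u', hu', rfl⟩ := h2 u hu e1
  have hu'' : u' ∈ X.gr q a := by simpa using hu'
  obtain ⟨v', hv', e⟩ := h1 (X.x i u' + v) (add_mem (X.x_mem i _ _ _ hu'') hv) (by
    rw [map_add, X.dx]; exact e2)
  refine ⟨-u', neg_mem hu'', v', hv', by simp, ?_⟩
  rw [e, map_neg]; abel

theorem GC.ex_of_cone {X : GC K n} {i : Fin n} {q a : ℤ} (h1 : (X.cone i).Ex (q - 1) a)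
    (h2 : X.Ex q (a + 1)) : X.Ex q a := by
  rw [GC.cone_Ex_iff] at h1
  intro z hz h
  obtain ⟨w, hw, e⟩ := h2 (X.x i z) (X.x_mem i _ _ _ hz) (by rw [X.dx, h, map_zero])
  obtain ⟨s, hs, t, ht, e1, e2⟩ := h1 z (by simpa using hz) (-w) (neg_mem hw) h
    (by rw [map_neg, e]; abel)
  exact ⟨-s, neg_mem hs, by rw [map_neg]; exact e1⟩

theorem GC.ex_of_cone' {X : GC K n} {i : Fin n} {q a : ℤ} (h1 : (X.cone i).Ex q a)
    (h2 : X.Ex q a) : X.Ex q (a + 1) := by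
  rw [GC.cone_Ex_iff] at h1
  intro z hz h
  obtain ⟨s, hs, t, ht, e1, e2⟩ := h1 0 (zero_mem _) z hz (map_zero _) (by rw [h, map_zero, add_zero])
  obtain ⟨s', hs', e3⟩ := h2 s hs (neg_eq_zero.1 e1)
  refine ⟨X.x i s' + t, add_mem (X.x_mem i _ _ _ hs') ht, ?_⟩
  rw [map_add, X.dx, e3, e2]

/-- Acyclicity of the iterated cone (Koszul complex) of a list of operators. -/
def KosAc : List (Fin n) → GC K n → Prop
  | [], X => ∀ q a, X.Ex q a
  | i :: l, X => KosAc l (X.cone i)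

theorem lemmaB (l : List (Fin n)) : ∀ (X : GC K n) (D j0 : ℤ), KosAc l X →
    (∀ q ≤ j0, X.Ex q (D - q)) → ∀ q ≤ j0, X.Ex q (D - 1 - q) := by
  induction l with
  | nil => intro X D j0 h _ q _; exact h _ _
  | cons i l ih =>
    intro X D j0 h hX q hq
    have hY : ∀ q ≤ j0 - 1, (X.cone i).Ex q (D - 1 - q) := by
      intro q hq
      apply GC.cone_ex
      · have := hX q (by omega); rwa [show D - 1 - q + 1 = D - q by ring]
      · have := hX (q + 1) (by omega); rwa [show D - 1 - q = D - (q + 1) by ring]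
    have hZ := ih (X.cone i) (D - 1) (j0 - 1) h hY
    apply GC.ex_of_cone (i := i)
    · have := hZ (q - 1) (by omega); rwa [show D - 1 - q = D - 1 - 1 - (q - 1) by ring]
    · have := hX q hq; rwa [show D - 1 - q + 1 = D - q by ring]

theorem lemmaC (l : List (Fin n)) : ∀ (X : GC K n) (D q0 : ℤ), KosAc l X →
    (∀ q, q0 ≤ q → X.Ex q (D - 1 - q)) → ∀ q, q0 ≤ q → X.Ex q (D - q) := by
  induction l with
  | nil => intro X D j0 h _ q _; exact h _ _
  | cons i l ih =>
    intro X D j0 h hX q hq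
    have hY : ∀ q, j0 ≤ q → (X.cone i).Ex q (D - 1 - 1 - q) := by
      intro q hq
      apply GC.cone_ex
      · have := hX q (by omega); rwa [show D - 1 - 1 - q + 1 = D - 1 - q by ring]
      · have := hX (q + 1) (by omega); rwa [show D - 1 - 1 - q = D - 1 - (q + 1) by ring]
    have hZ := ih (X.cone i) (D - 1) j0 h hY
    have := GC.ex_of_cone' (hZ q hq) (hX q hq)
    rwa [show D - 1 - q + 1 = D - q by ring] at this

theorem kosAc_of_acyclic (l : List (Fin n)) : ∀ (X : GC K n), (∀ q a, X.Ex q a) → KosAc l X := by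
  induction l with
  | nil => intro X h; exact h
  | cons i l ih => intro X h; exact ih _ fun q a => GC.cone_ex (h _ _) (h _ _)

/-- The operator `x i` is bijective. -/
def GC.Bij (X : GC K n) (i : Fin n) : Prop :=
  (∀ q a, ∀ u ∈ X.gr q a, X.x i u = 0 → u = 0) ∧
  (∀ q a, ∀ v ∈ X.gr q (a + 1), ∃ u ∈ X.gr q a, X.x i u = v)

theorem GC.Bij.cone {X : GC K n} {i : Fin n} (h : X.Bij i) (j : Fin n) : (X.cone j).Bij i := by
  refine ⟨?_, ?_⟩
  · rintro q a ⟨u, v⟩ ⟨hu, hv⟩ e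
    exact Prod.ext (h.1 _ _ _ hu (congrArg Prod.fst e)) (h.1 _ _ _ hv (congrArg Prod.snd e))
  · rintro q a ⟨u, v⟩ ⟨hu, hv⟩
    obtain ⟨u', hu', e1⟩ := h.2 _ _ _ hu
    obtain ⟨v', hv', e2⟩ := h.2 _ _ _ hv
    exact ⟨(u', v'), ⟨hu', hv'⟩, Prod.ext e1 e2⟩

theorem GC.Bij.acyclic {X : GC K n} {i : Fin n} (h : X.Bij i) (q a : ℤ) : (X.cone i).Ex q a := by
  rw [GC.cone_Ex_iff]
  intro u hu v hv e1 e2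
  obtain ⟨v', hv', rfl⟩ := h.2 _ _ _ hv
  have h0 : u + X.d v' = 0 := h.1 _ _ _ (add_mem hu (X.d_mem _ _ _ hv')) (by
    rw [map_add, ← X.dx]; exact e2)
  refine ⟨v', hv', 0, zero_mem _, ?_, by simp⟩
  rw [neg_eq_iff_add_eq_zero, add_comm]; exact h0

theorem kosAc_of_bij (l : List (Fin n)) (i : Fin n) (hi : i ∈ l) : ∀ (X : GC K n), X.Bij i →
    KosAc l X := by
  induction l with
  | nil => simp at hi
  | cons j l ih =>
    intro X h
    by_cases hj : i = j
    · subst hj; exact kosAc_of_acyclic l _ h.acyclic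
    · have : i ∈ l := by simpa [hj] using hi
      exact ih this _ (h.cone j)

/-- A graded short exact sequence of complexes. -/
structure GSes (Y Z X : GC K n) where
  i : Y.V →ₗ[K] Z.V
  p : Z.V →ₗ[K] X.V
  i_mem : ∀ q a v, v ∈ Y.gr q a → i v ∈ Z.gr q a
  p_mem : ∀ q a v, v ∈ Z.gr q a → p v ∈ X.gr q a
  i_d : ∀ v, i (Y.d v) = Z.d (i v)
  p_d : ∀ v, p (Z.d v) = X.d (p v)
  i_x : ∀ j v, i (Y.x j v) = Z.x j (i v)
  p_x : ∀ j v, p (Z.x j v) = X.x j (p v)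
  inj : ∀ q a, ∀ v ∈ Y.gr q a, i v = 0 → v = 0
  ex : ∀ q a, ∀ v ∈ Z.gr q a, p v = 0 → ∃ u ∈ Y.gr q a, i u = v
  surj : ∀ q a, ∀ v ∈ X.gr q a, ∃ u ∈ Z.gr q a, p u = v

def GSes.cone {Y Z X : GC K n} (s : GSes Y Z X) (j : Fin n) :
    GSes (Y.cone j) (Z.cone j) (X.cone j) where
  i := LinearMap.prodMap s.i s.i
  p := LinearMap.prodMap s.p s.p
  i_mem := by
    rintro q a ⟨u, v⟩ ⟨hu, hv⟩; exact ⟨s.i_mem _ _ _ hu, s.i_mem _ _ _ hv⟩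
  p_mem := by
    rintro q a ⟨u, v⟩ ⟨hu, hv⟩; exact ⟨s.p_mem _ _ _ hu, s.p_mem _ _ _ hv⟩
  i_d := by
    rintro ⟨u, v⟩
    refine Prod.ext ?_ ?_
    · show s.i (-(Y.d u)) = -(Z.d (s.i u)); rw [map_neg, s.i_d]
    · show s.i (Y.x j u + Y.d v) = Z.x j (s.i u) + Z.d (s.i v); rw [map_add, s.i_d, s.i_x]
  p_d := by
    rintro ⟨u, v⟩
    refine Prod.ext ?_ ?_
    · show s.p (-(Z.d u)) = -(X.d (s.p u)); rw [map_neg, s.p_d]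
    · show s.p (Z.x j u + Z.d v) = X.x j (s.p u) + X.d (s.p v); rw [map_add, s.p_d, s.p_x]
  i_x := by rintro k ⟨u, v⟩; exact Prod.ext (s.i_x k u) (s.i_x k v)
  p_x := by rintro k ⟨u, v⟩; exact Prod.ext (s.p_x k u) (s.p_x k v)
  inj := by
    rintro q a ⟨u, v⟩ ⟨hu, hv⟩ e
    exact Prod.ext (s.inj _ _ _ hu (congrArg Prod.fst e)) (s.inj _ _ _ hv (congrArg Prod.snd e))
  ex := by
    rintro q a ⟨u, v⟩ ⟨hu, hv⟩ e
    obtain ⟨u', hu', e1⟩ := s.ex _ _ _ hu (congrArg Prod.fst e)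
    obtain ⟨v', hv', e2⟩ := s.ex _ _ _ hv (congrArg Prod.snd e)
    exact ⟨(u', v'), ⟨hu', hv'⟩, Prod.ext e1 e2⟩
  surj := by
    rintro q a ⟨u, v⟩ ⟨hu, hv⟩
    obtain ⟨u', hu', rfl⟩ := s.surj _ _ _ hu
    obtain ⟨v', hv', rfl⟩ := s.surj _ _ _ hv
    exact ⟨(u', v'), ⟨hu', hv'⟩, rfl⟩

theorem GSes.exMid {Y Z X : GC K n} (s : GSes Y Z X) {q a : ℤ} (hY : Y.Ex q a) (hX : X.Ex q a) :
    Z.Ex q a := by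
  intro z hz h
  obtain ⟨u, hu, e⟩ := hX (s.p z) (s.p_mem _ _ _ hz) (by rw [← s.p_d, h, map_zero])
  obtain ⟨w, hw, rfl⟩ := s.surj _ _ _ hu
  have hdw : Z.d w ∈ Z.gr q a := by simpa using Z.d_mem _ _ _ hw
  obtain ⟨y, hy, e2⟩ := s.ex q a (z - Z.d w) (sub_mem hz hdw) (by rw [map_sub, s.p_d, e, sub_self])
  have hy0 : Y.d y = 0 := by
    apply s.inj _ _ _ (Y.d_mem _ _ _ hy)
    rw [s.i_d, e2, map_sub, h, Z.dd _ _ _ hw, sub_zero]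
  obtain ⟨y', hy', rfl⟩ := hY y hy hy0
  refine ⟨w + s.i y', add_mem hw (s.i_mem _ _ _ hy'), ?_⟩
  rw [map_add, ← s.i_d, e2]; abel

theorem GSes.kosAc (l : List (Fin n)) : ∀ {Y Z X : GC K n}, GSes Y Z X → KosAc l Y → KosAc l X →
    KosAc l Z := by
  induction l with
  | nil => intro Y Z X s hY hX q a; exact s.exMid (hY q a) (hX q a)
  | cons j l ih => intro Y Z X s hY hX; exact ih (s.cone j) hY hX

/-! ### Part 2: iterated fibres -/

/-- Shift of a complex by `s`. -/
def GC.shs (s : ℕ) (X : GC K n) : GC K n where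
  V := X.V
  gr q a := X.gr (q - s) a
  d := ((-1 : K) ^ s) • X.d
  x := X.x
  d_mem := by
    intro q a v hv
    have := X.d_mem _ _ _ hv
    rw [show q - (s : ℤ) + 1 = q + 1 - s by ring] at this
    exact Submodule.smul_mem _ _ this
  x_mem := fun i q a v hv => X.x_mem i _ _ _ hv
  dd := by
    intro q a v hv
    have := X.dd _ _ _ hv
    simp [this]
  dx := by intro i v; simp [X.dx]
  xx := X.xx

/-- A graded short exact sequence of complexes, exact only on graded pieces. -/
structure CSes (A B A' : GC K n) where
  j : A.V →ₗ[K] B.V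
  π : B.V →ₗ[K] A'.V
  j_mem : ∀ q a v, v ∈ A.gr q a → j v ∈ B.gr q a
  π_mem : ∀ q a v, v ∈ B.gr q a → π v ∈ A'.gr q a
  j_d : ∀ v, j (A.d v) = B.d (j v)
  π_d : ∀ v, π (B.d v) = A'.d (π v)
  j_x : ∀ i v, j (A.x i v) = B.x i (j v)
  π_x : ∀ i v, π (B.x i v) = A'.x i (π v)
  inj : ∀ q a, ∀ v ∈ A.gr q a, j v = 0 → v = 0
  πj : ∀ q a, ∀ v ∈ A.gr q a, π (j v) = 0
  ex : ∀ q a, ∀ v ∈ B.gr q a, π v = 0 → ∃ u ∈ A.gr q a, j u = v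
  surj : ∀ q a, ∀ v ∈ A'.gr q a, ∃ u ∈ B.gr q a, π u = v

/-- `T` sits in a length two resolution `A₀ → T → Γ`, totally acyclic, with `T` Koszul acyclic. -/
structure Fil (l : List (Fin n)) (A₀ : GC K n) (s : ℕ) (A : GC K n) where
  T : GC K n
  p : T.V →ₗ[K] A.V
  ι : A₀.V →ₗ[K] T.V
  p_mem : ∀ q a v, v ∈ T.gr q a → p v ∈ A.gr (q - s) a
  ι_mem : ∀ q a v, v ∈ A₀.gr q a → ι v ∈ T.gr q a
  p_d : ∀ q a, ∀ v ∈ T.gr q a, p (T.d v) = ((-1 : K) ^ s) • A.d (p v)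
  p_x : ∀ i v, p (T.x i v) = A.x i (p v)
  ι_d : ∀ q a, ∀ v ∈ A₀.gr q a, ι (A₀.d v) = T.d (ι v)
  kos : KosAc l T
  pι : ∀ q a, ∀ v ∈ A₀.gr q a, p (ι v) = 0
  tot : ∀ q a, ∀ a0 ∈ A₀.gr (q + 1) a, ∀ t ∈ T.gr q a, ∀ c ∈ A.gr (q - 1 - s) a,
    A₀.d a0 = 0 → ι a0 = T.d t → p t = ((-1 : K) ^ s) • A.d c →
    ∃ a0' ∈ A₀.gr q a, ∃ t' ∈ T.gr (q - 1) a, ∃ c' ∈ A.gr (q - 2 - s) a,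
      A₀.d a0' = a0 ∧ t = ι a0' + T.d t' ∧ c = p t' + ((-1 : K) ^ s) • A.d c'
  surj : ∀ q a, ∀ c ∈ A.gr (q - s) a, ∃ t ∈ T.gr q a, p t = c

def CSes.base {A B A' : GC K n} (S : CSes A B A') (l : List (Fin n)) (i : Fin n) (hi : i ∈ l)
    (hB : B.Bij i) : Fil l A 0 A' where
  T := B
  p := S.π
  ι := S.j
  p_mem := by intro q a v hv; simpa using S.π_mem _ _ _ hv
  ι_mem := S.j_mem
  p_d := by intro q a v hv; simpa using S.π_d v
  p_x := S.π_x
  ι_d := fun q a v _ => S.j_d v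
  kos := kosAc_of_bij l i hi _ hB
  pι := S.πj
  tot := by
    intro q a a0 ha t ht c hc h1 h2 h3
    simp only [Nat.cast_zero, sub_zero, pow_zero, one_smul] at hc h3 ⊢
    obtain ⟨e, he, rfl⟩ := S.surj _ _ _ hc
    have hde : B.d e ∈ B.gr q a := by simpa using B.d_mem _ _ _ he
    obtain ⟨a0', ha', e1⟩ := S.ex _ _ (t - B.d e) (sub_mem ht hde) (by
      rw [map_sub, h3, S.π_d, sub_self])
    refine ⟨a0', ha', e, he, 0, zero_mem _, ?_, ?_, by simp⟩
    · have : A.d a0' - a0 = 0 := by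
        apply S.inj _ _ _ (sub_mem (A.d_mem _ _ _ ha') ha)
        rw [map_sub, S.j_d, e1, map_sub, B.dd _ _ _ he, h2]; simp
      exact sub_eq_zero.1 this
    · rw [e1]; abel
  surj := by intro q a c hc; simpa using S.surj q a c (by simpa using hc)

/-- The fibre complex. -/
def Fil.T' {l : List (Fin n)} {A₀ A B A' : GC K n} {s : ℕ} (f : Fil l A₀ s A) (S : CSes A B A') :
    GC K n where
  V := f.T.V × B.V
  gr q a := (f.T.gr q a).prod (B.gr (q - (s + 1)) a)
  d := LinearMap.prod (f.T.d ∘ₗ LinearMap.fst K _ _)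
    (S.j ∘ₗ f.p ∘ₗ LinearMap.fst K _ _ - ((-1 : K) ^ s) • B.d ∘ₗ LinearMap.snd K _ _)
  x i := LinearMap.prodMap (f.T.x i) (B.x i)
  d_mem := by
    rintro q a ⟨t, b⟩ ⟨ht, hb⟩
    refine ⟨f.T.d_mem _ _ _ ht, ?_⟩
    show S.j (f.p t) - ((-1 : K) ^ s) • B.d b ∈ _
    have h1 := S.j_mem _ _ _ (f.p_mem _ _ _ ht)
    have h2 := B.d_mem _ _ _ hb
    rw [show q - ((s : ℤ) + 1) + 1 = q - s by ring] at h2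
    rw [show q + 1 - ((s : ℤ) + 1) = q - s by ring]
    exact sub_mem h1 (Submodule.smul_mem _ _ h2)
  x_mem := by
    rintro j q a ⟨u, v⟩ ⟨hu, hv⟩
    exact ⟨f.T.x_mem j _ _ _ hu, B.x_mem j _ _ _ hv⟩
  dd := by
    rintro q a ⟨t, b⟩ ⟨ht, hb⟩
    have h1 := f.T.dd _ _ _ ht
    have h2 := B.dd _ _ _ hb
    have h3 := f.p_d _ _ _ ht
    refine Prod.ext h1 ?_
    show S.j (f.p (f.T.d t)) - ((-1 : K) ^ s) • B.d (S.j (f.p t) - ((-1 : K) ^ s) • B.d b) = 0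
    rw [h3, map_smul, S.j_d, map_sub, map_smul, h2]; simp
  dx := by
    rintro j ⟨u, v⟩
    refine Prod.ext (f.T.dx j u) ?_
    show S.j (f.p (f.T.x j u)) - ((-1 : K) ^ s) • B.d (B.x j v) =
      B.x j (S.j (f.p u) - ((-1 : K) ^ s) • B.d v)
    rw [f.p_x, S.j_x, B.dx]; simp
  xx := by
    rintro i j ⟨u, v⟩
    exact Prod.ext (f.T.xx i j u) (B.xx i j v)

theorem GC.Bij.shs {X : GC K n} {i : Fin n} (h : X.Bij i) (s : ℕ) : (X.shs s).Bij i :=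
  ⟨fun q a => h.1 _ _, fun q a => h.2 _ _⟩

def Fil.gses {l : List (Fin n)} {A₀ A B A' : GC K n} {s : ℕ} (f : Fil l A₀ s A) (S : CSes A B A') :
    GSes (B.shs (s + 1)) (f.T' S) f.T where
  i := LinearMap.inr K f.T.V B.V
  p := LinearMap.fst K f.T.V B.V
  i_mem := by
    intro q a v hv
    refine ⟨zero_mem _, ?_⟩
    have : v ∈ B.gr (q - ((s + 1 : ℕ) : ℤ)) a := hv
    push_cast at this
    exact this
  p_mem := fun q a v hv => hv.1
  i_d := by
    intro v
    refine Prod.ext (map_zero f.T.d).symm ?_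
    show ((-1 : K) ^ (s + 1)) • B.d v = S.j (f.p 0) - ((-1 : K) ^ s) • B.d v
    simp [pow_succ]
  p_d := fun v => rfl
  i_x := by
    intro j v
    exact Prod.ext (map_zero (f.T.x j)).symm rfl
  p_x := fun j v => rfl
  inj := fun q a v hv e => congrArg Prod.snd e
  ex := by
    rintro q a ⟨t, b⟩ ⟨ht, hb⟩ e
    have e' : t = 0 := e
    refine ⟨b, ?_, Prod.ext e'.symm rfl⟩
    show b ∈ B.gr (q - ((s + 1 : ℕ) : ℤ)) a
    push_cast
    exact hb
  surj := fun q a v hv => ⟨(v, 0), ⟨hv, zero_mem _⟩, rfl⟩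

def Fil.step {l : List (Fin n)} {A₀ A B A' : GC K n} {s : ℕ} (f : Fil l A₀ s A) (S : CSes A B A')
    (i : Fin n) (hi : i ∈ l) (hB : B.Bij i) : Fil l A₀ (s + 1) A' where
  T := f.T' S
  p := S.π ∘ₗ LinearMap.snd K f.T.V B.V
  ι := LinearMap.inl K f.T.V B.V ∘ₗ f.ι
  p_mem := by
    rintro q a ⟨t, b⟩ ⟨ht, hb⟩
    have := S.π_mem _ _ _ hb
    push_cast
    exact this
  ι_mem := fun q a v hv => ⟨f.ι_mem _ _ _ hv, zero_mem _⟩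
  p_d := by
    rintro q a ⟨t, b⟩ ⟨ht, hb⟩
    show S.π (S.j (f.p t) - ((-1 : K) ^ s) • B.d b) = ((-1 : K) ^ (s + 1)) • A'.d (S.π b)
    rw [map_sub, S.πj _ _ _ (f.p_mem _ _ _ ht), map_smul, S.π_d, pow_succ]
    simp
  p_x := by
    rintro j ⟨t, b⟩
    exact S.π_x j b
  ι_d := by
    intro q a v hv
    refine Prod.ext (f.ι_d _ _ v hv) ?_
    show 0 = S.j (f.p (f.ι v)) - ((-1 : K) ^ s) • B.d 0
    rw [f.pι _ _ v hv]; simp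
  kos := (f.gses S).kosAc l (kosAc_of_bij l i hi _ (hB.shs _)) f.kos
  pι := fun q a v hv => map_zero S.π
  tot := by
    rintro q a a0 ha ⟨t, b⟩ ⟨ht, hb⟩ c hc h1 h2 h3
    push_cast at hc
    have h2a : f.ι a0 = f.T.d t := congrArg Prod.fst h2
    have h2b : 0 = S.j (f.p t) - ((-1 : K) ^ s) • B.d b := congrArg Prod.snd h2
    have h3' : S.π b = ((-1 : K) ^ (s + 1)) • A'.d c := h3
    have hb' : b ∈ B.gr (q - (s + 1)) a := hb
    have ht' : t ∈ f.T.gr q a := ht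
    obtain ⟨e, he, rfl⟩ := S.surj _ _ _ hc
    have hde : B.d e ∈ B.gr (q - (s + 1)) a := by
      have := B.d_mem _ _ _ he
      rwa [show q - 1 - ((s : ℤ) + 1) + 1 = q - (s + 1) by ring] at this
    obtain ⟨a1, ha1, e1⟩ := S.ex _ _ (b - ((-1 : K) ^ (s + 1)) • B.d e)
      (sub_mem hb' (Submodule.smul_mem _ _ hde)) (by
      rw [map_sub, h3', map_smul, S.π_d, sub_self])
    have hda1 : A.d a1 ∈ A.gr (q - s) a := by
      have := A.d_mem _ _ _ ha1
      rwa [show q - ((s : ℤ) + 1) + 1 = q - s by ring] at this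
    have e2 : f.p t = ((-1 : K) ^ s) • A.d a1 := by
      apply sub_eq_zero.1
      apply S.inj _ _ _ (sub_mem (f.p_mem _ _ _ ht') (Submodule.smul_mem _ _ hda1))
      rw [map_sub, map_smul, S.j_d, e1, map_sub, map_smul, B.dd _ _ _ he, smul_zero, sub_zero]
      exact h2b.symm
    rw [show q - ((s : ℤ) + 1) = q - 1 - s by ring] at ha1
    obtain ⟨a0', ha0', t', ht', c', hc', f1, f2, f3⟩ := f.tot q a a0 ha t ht' a1 ha1 h1 h2a e2
    refine ⟨a0', ha0', (t', e - S.j c'), ⟨ht', sub_mem he ?_⟩, 0, zero_mem _, f1, ?_, ?_⟩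
    · have := S.j_mem _ _ _ hc'
      rwa [show q - 2 - (s : ℤ) = q - 1 - (s + 1) by ring] at this
    · refine Prod.ext f2 ?_
      show b = 0 + (S.j (f.p t') - ((-1 : K) ^ s) • B.d (e - S.j c'))
      have : b = S.j a1 + ((-1 : K) ^ (s + 1)) • B.d e := by rw [e1]; abel
      rw [this, f3, map_add, map_smul, S.j_d, map_sub, pow_succ]
      simp only [mul_neg, mul_one, neg_smul, smul_sub]
      abel
    · show S.π e = S.π (e - S.j c') + _
      rw [map_sub, S.πj _ _ _ hc']; simp
  surj := by
    intro q a c hc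
    push_cast at hc
    obtain ⟨b, hb, e⟩ := S.surj _ _ _ hc
    exact ⟨(0, b), ⟨zero_mem _, hb⟩, e⟩

/-! ### Part 3: the complexes `Hom(F, N)` -/

theorem homogZ_nat (k : ℕ) : homogZ K n (k : ℤ) = MvPolynomial.homogeneousSubmodule (Fin n) K k := by
  simp [homogZ]

theorem homogZ_neg {z : ℤ} (hz : z < 0) : homogZ K n z = ⊥ := by
  simp [homogZ, not_le.2 hz]

theorem X_mem_homogZ (i : Fin n) : (X i : PolyS K n) ∈ homogZ K n 1 := by
  have := homogZ_nat (K := K) (n := n) 1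
  rw [Nat.cast_one] at this
  rw [this, mem_homogeneousSubmodule]
  exact isHomogeneous_X _ _

/-- A graded module over the polynomial ring. -/
structure GM (K : Type) [Field K] (n : ℕ) where
  N : Type
  [ag : AddCommGroup N]
  [mo : Module K N]
  [mS : Module (PolyS K n) N]
  [st : IsScalarTower K (PolyS K n) N]
  gr : ℤ → Submodule K N
  smul_mem : ∀ j z s f, s ∈ homogZ K n j → f ∈ gr z → s • f ∈ gr (z + j)

attribute [instance] GM.ag GM.mo GM.mS GM.st

/-- The differential of `Hom(F, N)`. -/
def CtdFun (F : FreeComplex K n) (N : GM K n) (v : (k : ℕ) → Fin (F.rk k) → N.N) :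
    (k : ℕ) → Fin (F.rk k) → N.N
  | 0 => 0
  | k + 1 => fun p' => ∑ p, F.dd k p p' • v k p

/-- The differential of `Hom(F, N)`, as a linear map. -/
def Ctd (F : FreeComplex K n) (N : GM K n) :
    ((k : ℕ) → Fin (F.rk k) → N.N) →ₗ[K] ((k : ℕ) → Fin (F.rk k) → N.N) where
  toFun := CtdFun F N
  map_add' := by
    intro u v
    funext k
    cases k with
    | zero => simp [CtdFun]
    | succ k => funext p; simp [CtdFun, Finset.sum_add_distrib]
  map_smul' := by
    intro c v
    funext k
    cases k with
    | zero => simp [CtdFun]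
    | succ k =>
      funext p
      simp only [CtdFun, Pi.smul_apply, Finset.smul_sum, RingHom.id_apply]
      refine Finset.sum_congr rfl fun q _ => ?_
      rw [smul_algebra_smul_comm]

theorem Ctd_succ (F : FreeComplex K n) (N : GM K n) (v) (k) (p') :
  Ctd F N v (k + 1) p' = ∑ p, F.dd k p p' • v k p := rfl

theorem Ctd_zero (F : FreeComplex K n) (N : GM K n) (v) (p') :
  Ctd F N v 0 p' = 0 := rfl

/-- The grading of `Hom(F, N)`. -/
def Ctgr (F : FreeComplex K n) (N : GM K n) (q a : ℤ) :
    Submodule K ((k : ℕ) → Fin (F.rk k) → N.N) where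
  carrier := {v | ∀ k p, v k p ∈ N.gr (a + F.deg k p) ∧ ((k : ℤ) ≠ q → v k p = 0)}
  add_mem' := by
    intro u v hu hv k p
    refine ⟨add_mem (hu k p).1 (hv k p).1, fun h => ?_⟩
    simp [(hu k p).2 h, (hv k p).2 h]
  zero_mem' := fun k p => ⟨zero_mem _, fun _ => rfl⟩
  smul_mem' := by
    intro c v hv k p
    refine ⟨Submodule.smul_mem _ _ (hv k p).1, fun h => ?_⟩
    simp [(hv k p).2 h]

/-- The complex `Hom(F, N)`. -/
def Ct (F : FreeComplex K n) (N : GM K n) : GC K n where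
  V := (k : ℕ) → Fin (F.rk k) → N.N
  gr := Ctgr F N
  d := Ctd F N
  x i := 
    { toFun := fun v k p => (X i : PolyS K n) • v k p
      map_add' := by intro u v; funext k p; simp
      map_smul' := by intro c v; funext k p; exact (smul_algebra_smul_comm c (X i : PolyS K n) (v k p)) }
  d_mem := by
    intro q a v hv k p'
    cases k with
    | zero => exact ⟨zero_mem _, fun _ => rfl⟩
    | succ k =>
      refine ⟨?_, ?_⟩
      · rw [Ctd_succ]
        refine Submodule.sum_mem _ fun p _ => ?_
        have := N.smul_mem _ _ _ _ (F.isHomog k p p') (hv k p).1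
        rwa [show a + F.deg k p + (F.deg (k + 1) p' - F.deg k p) = a + F.deg (k+1) p' by ring]
          at this
      · intro h
        rw [Ctd_succ]
        refine Finset.sum_eq_zero fun p _ => ?_
        rw [(hv k p).2 (by push_cast at h; omega), smul_zero]
  x_mem := by
    intro i q a v hv k p
    refine ⟨?_, fun h => ?_⟩
    · have := N.smul_mem _ _ _ _ (X_mem_homogZ i) (hv k p).1
      rwa [show a + F.deg k p + 1 = a + 1 + F.deg k p by ring] at this
    · show (X i : PolyS K n) • v k p = 0
      rw [(hv k p).2 h, smul_zero]
  dd := by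
    intro q a v hv
    funext k p''
    cases k with
    | zero => rfl
    | succ k =>
      cases k with
      | zero => 
        rw [Ctd_succ]
        refine Finset.sum_eq_zero fun p _ => ?_
        rw [Ctd_zero, smul_zero]
      | succ k =>
        rw [Ctd_succ]
        simp only [Ctd_succ, Finset.smul_sum, smul_smul]
        rw [Finset.sum_comm]
        refine Finset.sum_eq_zero fun p _ => ?_
        rw [← Finset.sum_smul]
        have := congrFun (congrFun (F.isComplex k) p) p''
        rw [Matrix.mul_apply] at this
        simp only [mul_comm (F.dd (k+1) _ _)]
        rw [this]
        simp
  dx := by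
    intro i v
    funext k p'
    cases k with
    | zero => exact (smul_zero _).symm
    | succ k =>
      show ∑ p, F.dd k p p' • (X i : PolyS K n) • v k p = (X i : PolyS K n) • ∑ p, F.dd k p p' • v k p
      rw [Finset.smul_sum]
      exact Finset.sum_congr rfl fun p _ => smul_comm _ _ _
  xx := by
    intro i j v
    funext k p
    exact smul_comm _ _ _

/-- Graded short exact sequence of modules. -/
structure MSes (N W N' : GM K n) where
  j : N.N →ₗ[PolyS K n] W.N
  π : W.N →ₗ[PolyS K n] N'.N
  j_mem : ∀ z v, v ∈ N.gr z → j v ∈ W.gr z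
  π_mem : ∀ z v, v ∈ W.gr z → π v ∈ N'.gr z
  inj : ∀ z, ∀ v ∈ N.gr z, j v = 0 → v = 0
  πj : ∀ z, ∀ v ∈ N.gr z, π (j v) = 0
  ex : ∀ z, ∀ v ∈ W.gr z, π v = 0 → ∃ u ∈ N.gr z, j u = v
  surj : ∀ z, ∀ v ∈ N'.gr z, ∃ u ∈ W.gr z, π u = v

/-- Functoriality. -/
def Ctmap (F : FreeComplex K n) {N N' : GM K n} (f : N.N →ₗ[PolyS K n] N'.N) :
    ((k : ℕ) → Fin (F.rk k) → N.N) →ₗ[K] ((k : ℕ) → Fin (F.rk k) → N'.N) where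
  toFun v k p := f (v k p)
  map_add' := by intro u v; funext k p; simp
  map_smul' := by
    intro c v; funext k p
    exact LinearMap.map_smul_of_tower f c (v k p)

theorem Ctmap_mem (F : FreeComplex K n) {N N' : GM K n} (f : N.N →ₗ[PolyS K n] N'.N)
    (hf : ∀ z v, v ∈ N.gr z → f v ∈ N'.gr z) (q a v) (hv : v ∈ (Ct F N).gr q a) :
    Ctmap F f v ∈ (Ct F N').gr q a := by
  intro k p
  refine ⟨hf _ _ (hv k p).1, fun h => ?_⟩
  show f (v k p) = 0
  rw [(hv k p).2 h, map_zero]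

theorem Ctmap_d (F : FreeComplex K n) {N N' : GM K n} (f : N.N →ₗ[PolyS K n] N'.N) (v) :
    Ctmap F f ((Ct F N).d v) = (Ct F N').d (Ctmap F f v) := by
  funext k p'
  cases k with
  | zero => exact map_zero f
  | succ k =>
    show f (∑ p, F.dd k p p' • v k p) = ∑ p, F.dd k p p' • f (v k p)
    simp

theorem Ctmap_x (F : FreeComplex K n) {N N' : GM K n} (f : N.N →ₗ[PolyS K n] N'.N) (i v) :
    Ctmap F f ((Ct F N).x i v) = (Ct F N').x i (Ctmap F f v) := by
  funext k p
  exact map_smul f _ _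

theorem Ct_lift (F : FreeComplex K n) {N N' : GM K n} (f : N.N → N'.N) (e : ℤ)
    (q a : ℤ) (v) (hv : v ∈ (Ct F N').gr q (a + e))
    (h : ∀ z, ∀ k p, v k p ∈ N'.gr (z + e) → ∃ u ∈ N.gr z, f u = v k p) :
    ∃ u ∈ (Ct F N).gr q a, ∀ (k : ℕ) p, (k : ℤ) = q → f (u k p) = v k p := by
  have h' : ∀ k p, ∃ u ∈ N.gr (a + F.deg k p), f u = v k p := fun k p => h _ k p (by
    have := (hv k p).1
    rwa [show a + e + F.deg k p = a + F.deg k p + e by ring] at this)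
  choose u hu e using h'
  refine ⟨fun k p => if (k : ℤ) = q then u k p else 0, ?_, ?_⟩
  · intro k p
    by_cases hk : (k : ℤ) = q
    · simp [hk, hu]
    · simp [hk]
  · intro k p hk
    simp [hk, e]

def MSes.ct {N W N' : GM K n} (S : MSes N W N') (F : FreeComplex K n) :
    CSes (Ct F N) (Ct F W) (Ct F N') where
  j := Ctmap F S.j
  π := Ctmap F S.π
  j_mem := Ctmap_mem F S.j S.j_mem
  π_mem := Ctmap_mem F S.π S.π_mem
  j_d := Ctmap_d F S.j
  π_d := Ctmap_d F S.π
  j_x := Ctmap_x F S.j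
  π_x := Ctmap_x F S.π
  inj := by
    intro q a v hv h
    funext k p
    exact S.inj _ _ (hv k p).1 (congrFun (congrFun h k) p)
  πj := by
    intro q a v hv
    funext k p
    exact S.πj _ _ (hv k p).1
  ex := by
    intro q a v hv h
    obtain ⟨u, hu, e⟩ := Ct_lift F (N := N) (N' := W) S.j 0 q a v (by simpa using hv)
      (fun z k p hz => S.ex _ _ (by simpa using hz) (congrFun (congrFun h k) p))
    refine ⟨u, hu, ?_⟩
    funext k p
    by_cases hk : (k : ℤ) = q
    · exact e k p hk
    · show S.j (u k p) = v k p
      rw [(hu k p).2 hk, (hv k p).2 hk, map_zero]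
  surj := by
    intro q a v hv
    obtain ⟨u, hu, e⟩ := Ct_lift F (N := W) (N' := N') S.π 0 q a v (by simpa using hv)
      (fun z k p hz => S.surj _ _ (by simpa using hz))
    refine ⟨u, hu, ?_⟩
    funext k p
    by_cases hk : (k : ℤ) = q
    · exact e k p hk
    · show S.π (u k p) = v k p
      rw [(hu k p).2 hk, (hv k p).2 hk, map_zero]

theorem Ct_bij (F : FreeComplex K n) (W : GM K n) (i : Fin n)
    (h1 : ∀ z, ∀ u ∈ W.gr z, (X i : PolyS K n) • u = 0 → u = 0)
    (h2 : ∀ z, ∀ v ∈ W.gr (z + 1), ∃ u ∈ W.gr z, (X i : PolyS K n) • u = v) :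
    (Ct F W).Bij i := by
  refine ⟨?_, ?_⟩
  · intro q a u hu e
    funext k p
    exact h1 _ _ (hu k p).1 (congrFun (congrFun e k) p)
  · intro q a v hv
    obtain ⟨u, hu, e⟩ := Ct_lift F (N := W) (N' := W) (fun w => (X i : PolyS K n) • w) 1 q a v hv
      (fun z k p hz => h2 _ _ hz)
    refine ⟨u, hu, ?_⟩
    funext k p
    by_cases hk : (k : ℤ) = q
    · exact e k p hk
    · show (X i : PolyS K n) • u k p = v k p
      rw [(hu k p).2 hk, (hv k p).2 hk, smul_zero]

/-! ### Part 4: Laurent monomial modules -/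

/-- Laurent polynomials. -/
abbrev Lau (K : Type) [Field K] (n : ℕ) : Type := AddMonoidAlgebra K (Fin n → ℤ)

/-- Embedding of exponents. -/
def emb (n : ℕ) : (Fin n →₀ ℕ) →+ (Fin n → ℤ) where
  toFun v i := v i
  map_zero' := by funext i; simp
  map_add' := by intro u v; funext i; simp

theorem emb_apply (v : Fin n →₀ ℕ) (i : Fin n) : emb n v i = v i := rfl

theorem emb_inj {v w : Fin n →₀ ℕ} (h : emb n v = emb n w) : v = w := by
  ext i
  have := congrFun h i
  simpa [emb_apply] using this

/-- The inclusion of polynomials in Laurent polynomials. -/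
def toL (K : Type) [Field K] (n : ℕ) : PolyS K n →ₐ[K] Lau K n :=
  AddMonoidAlgebra.mapDomainAlgHom K K (emb n)

instance lauAlg : Algebra (PolyS K n) (Lau K n) := (toL K n).toRingHom.toAlgebra

theorem lau_smul (s : PolyS K n) (f : Lau K n) : s • f = toL K n s * f := rfl

instance lauTower : IsScalarTower K (PolyS K n) (Lau K n) :=
  IsScalarTower.of_algebraMap_eq fun c => ((toL K n).commutes c).symm

theorem toL_monomial (v : Fin n →₀ ℕ) (c : K) :
    toL K n (monomial v c) = AddMonoidAlgebra.single (emb n v) c := by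
  rw [← single_eq_monomial]
  exact AddMonoidAlgebra.mapDomain_single 

theorem coeff_mono_smul (v : Fin n →₀ ℕ) (c : K) (f : Lau K n) (u : Fin n → ℤ) :
    (monomial v c • f : Lau K n).coeff u = c * f.coeff (u - emb n v) := by
  rw [lau_smul, toL_monomial, AddMonoidAlgebra.coeff_single_mul_apply]
  congr 2
  abel

theorem coeff_smul_L (s : PolyS K n) (f : Lau K n) (u : Fin n → ℤ) :
    (s • f : Lau K n).coeff u = ∑ v ∈ s.support, MvPolynomial.coeff v s * f.coeff (u - emb n v) := by
  conv_lhs => rw [s.as_sum]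
  rw [Finset.sum_smul, AddMonoidAlgebra.coeff_sum, Finsupp.finset_sum_apply]
  exact Finset.sum_congr rfl fun v _ => coeff_mono_smul _ _ _ _

/-- Sets of exponents closed under adding monomials. -/
def UpS (U : Set (Fin n → ℤ)) : Prop := ∀ u v, u - emb n v ∈ U → u ∈ U

/-- Laurent polynomials supported in `U`. -/
def supL (K : Type) [Field K] {n : ℕ} (U : Set (Fin n → ℤ)) : Submodule K (Lau K n) where
  carrier := {f | ∀ u, f.coeff u ≠ 0 → u ∈ U}
  add_mem' := by
    intro f g hf hg u hu
    by_cases h : f.coeff u = 0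
    · exact hg u (by simpa [h] using hu)
    · exact hf u h
  zero_mem' := by intro u hu; simp at hu
  smul_mem' := by
    intro c f hf u hu
    exact hf u fun h => hu (by simp [h])

theorem exists_of_smul_ne {s : PolyS K n} {f : Lau K n} {u : Fin n → ℤ}
    (h : (s • f : Lau K n).coeff u ≠ 0) :
    ∃ v, MvPolynomial.coeff v s ≠ 0 ∧ f.coeff (u - emb n v) ≠ 0 := by
  rw [coeff_smul_L] at h
  obtain ⟨v, _, hv⟩ := Finset.exists_ne_zero_of_sum_ne_zero h
  exact ⟨v, left_ne_zero_of_mul hv, right_ne_zero_of_mul hv⟩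

/-- The same, as a module over the polynomial ring. -/
def supS (K : Type) [Field K] {n : ℕ} (U : Set (Fin n → ℤ)) (hU : UpS U) :
    Submodule (PolyS K n) (Lau K n) where
  carrier := supL K U
  add_mem' := fun ha hb => add_mem ha hb
  zero_mem' := zero_mem _
  smul_mem' := by
    intro s f hf u hu
    obtain ⟨v, _, hv⟩ := exists_of_smul_ne hu
    exact hU _ _ (hf _ hv)

/-- Exponents of total degree `z`. -/
def degS (n : ℕ) (z : ℤ) : Set (Fin n → ℤ) := {u | ∑ i, u i = z}

theorem homogZ_coeff {j : ℤ} {s : PolyS K n} (hs : s ∈ homogZ K n j) {v : Fin n →₀ ℕ}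
    (hv : MvPolynomial.coeff v s ≠ 0) : ∑ i, (v i : ℤ) = j := by
  rcases lt_or_ge j 0 with h | h
  · rw [homogZ_neg h, Submodule.mem_bot] at hs
    simp [hs] at hv
  · lift j to ℕ using h
    rw [homogZ_nat, mem_homogeneousSubmodule] at hs
    have := hs hv
    rw [Finsupp.weight_apply, Finsupp.sum_fintype _ _ (by simp)] at this
    rw [← this]
    simp

theorem mem_homogZ_of {j : ℤ} {s : PolyS K n}
    (h : ∀ v, MvPolynomial.coeff v s ≠ 0 → ∑ i, (v i : ℤ) = j) : s ∈ homogZ K n j := by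
  rcases lt_or_ge j 0 with hj | hj
  · have : s = 0 := by
      ext v
      by_contra hv
      have := h v hv
      have h2 : 0 ≤ ∑ i, (v i : ℤ) := Finset.sum_nonneg fun i _ => by positivity
      omega
    rw [this]; exact zero_mem _
  · lift j to ℕ using hj
    rw [homogZ_nat, mem_homogeneousSubmodule]
    intro v hv
    rw [Finsupp.weight_apply, Finsupp.sum_fintype _ _ (by simp)]
    have := h v hv
    simp only [smul_eq_mul, Pi.one_apply, mul_one]
    exact_mod_cast this

/-- The monomial module on the region `X ∖ U`. -/
def Reg (K : Type) [Field K] {n : ℕ} (U X : Set (Fin n → ℤ)) (hU : UpS U) (hX : UpS X) :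
    GM K n where
  N := Lau K n ⧸ supS K U hU
  gr z := (supL K (X ∩ degS n z)).map ((supS K U hU).mkQ.restrictScalars K)
  smul_mem := by
    rintro j z s _ hs ⟨f, hf, rfl⟩
    refine ⟨s • f, ?_, by simp⟩
    intro u hu
    obtain ⟨v, hv1, hv2⟩ := exists_of_smul_ne hu
    have h := hf _ hv2
    refine ⟨hX _ _ h.1, ?_⟩
    have h2 : ∑ i, (u - emb n v) i = z := h.2
    have h3 := homogZ_coeff hs hv1
    show ∑ i, u i = z + j
    rw [← h2, ← h3, ← Finset.sum_add_distrib]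
    exact Finset.sum_congr rfl fun i _ => by simp [emb_apply]

theorem mem_Reg {U X : Set (Fin n → ℤ)} {hU : UpS U} {hX : UpS X} {z : ℤ}
    {v : Lau K n ⧸ supS K U hU} : v ∈ (Reg K U X hU hX).gr z ↔
      ∃ f : Lau K n, f ∈ supL K (X ∩ degS n z) ∧ (supS K U hU).mkQ f = v := Iff.rfl

/-- Restriction of a Laurent polynomial to a set of exponents. -/
def cut (X : Set (Fin n → ℤ)) (f : Lau K n) : Lau K n := by
  classical exact AddMonoidAlgebra.ofCoeff (f.coeff.filter (· ∈ X))

theorem cut_in {X : Set (Fin n → ℤ)} (f : Lau K n) {u} (h : u ∈ X) : (cut X f).coeff u = f.coeff u := by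
  classical
  simp [cut, h]

theorem cut_out {X : Set (Fin n → ℤ)} (f : Lau K n) {u} (h : u ∉ X) : (cut X f).coeff u = 0 := by
  classical
  simp [cut, h]

/-- The exact sequence of regions. -/
def RegSes {U U' X X' : Set (Fin n → ℤ)} (hU : UpS U) (hU' : UpS U') (hX : UpS X) (hX' : UpS X')
    (h1 : U ⊆ U') (h2 : X ⊆ X') (h3 : X ⊆ U') (h4 : X' ∩ U' ⊆ X ∪ U) :
    MSes (Reg K U X hU hX) (Reg K U X' hU hX') (Reg K U' X' hU' hX') where
  j := LinearMap.id
  π := Submodule.factor (show supS K U hU ≤ supS K U' hU' from fun f hf u hu => h1 (hf u hu))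
  j_mem := by
    rintro z _ ⟨f, hf, rfl⟩
    exact ⟨f, fun u hu => ⟨h2 (hf u hu).1, (hf u hu).2⟩, rfl⟩
  π_mem := by
    rintro z _ ⟨f, hf, rfl⟩
    exact ⟨f, hf, rfl⟩
  inj := fun z v hv h => h
  πj := by
    rintro z _ ⟨f, hf, rfl⟩
    show (supS K U' hU').mkQ f = 0
    rw [Submodule.mkQ_apply, Submodule.Quotient.mk_eq_zero]
    exact fun u hu => h3 (hf u hu).1
  ex := by
    rintro z _ ⟨f, hf, rfl⟩ h
    have h : (supS K U' hU').mkQ f = 0 := h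
    rw [Submodule.mkQ_apply, Submodule.Quotient.mk_eq_zero] at h
    refine ⟨(supS K U hU).mkQ (cut X f), ⟨cut X f, ?_, rfl⟩, ?_⟩
    · intro u hu
      by_cases hx : u ∈ X
      · rw [cut_in f hx] at hu
        exact ⟨hx, (hf u hu).2⟩
      · rw [cut_out f hx] at hu; exact absurd rfl hu
    · show (supS K U hU).mkQ (cut X f) = (supS K U hU).mkQ f
      rw [← sub_eq_zero, ← map_sub, Submodule.mkQ_apply, Submodule.Quotient.mk_eq_zero]
      intro u hu
      rw [AddMonoidAlgebra.coeff_sub, Finsupp.sub_apply] at hu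
      by_cases hx : u ∈ X
      · rw [cut_in f hx, sub_self] at hu; exact absurd rfl hu
      · rw [cut_out f hx, zero_sub, neg_ne_zero] at hu
        exact (h4 ⟨(hf u hu).1, h u hu⟩).resolve_left hx
  surj := by
    rintro z _ ⟨f, hf, rfl⟩
    exact ⟨(supS K U hU).mkQ f, ⟨f, hf, rfl⟩, rfl⟩

theorem emb_single (i : Fin n) : emb n (Finsupp.single i 1) = Pi.single i 1 := by
  classical
  funext k
  simp [emb_apply, Finsupp.single_apply, Pi.single_apply, eq_comm]

theorem coeff_X_smul (i : Fin n) (f : Lau K n) (u : Fin n → ℤ) :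
    ((X i : PolyS K n) • f : Lau K n).coeff u = f.coeff (u - Pi.single i 1) := by
  have := coeff_mono_smul (K := K) (Finsupp.single i 1) 1 f u
  rwa [one_mul, emb_single] at this

theorem Reg_bij {U X' : Set (Fin n → ℤ)} (hU : UpS U) (hX' : UpS X') (i : Fin n)
    (h1 : ∀ u, u ∈ U → u - Pi.single i 1 ∈ U) (h2 : ∀ u, u ∈ X' → u - Pi.single i 1 ∈ X')
    (F : FreeComplex K n) : (Ct F (Reg K U X' hU hX')).Bij i := by
  apply Ct_bij
  · rintro z _ ⟨f, hf, rfl⟩ h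
    have h : (supS K U hU).mkQ ((X i : PolyS K n) • f) = 0 := by rw [map_smul]; exact h
    show (supS K U hU).mkQ f = 0
    rw [Submodule.mkQ_apply, Submodule.Quotient.mk_eq_zero] at h ⊢
    intro u hu
    have := h1 _ (h (u + Pi.single i 1) (by rw [coeff_X_smul, add_sub_cancel_right]; exact hu))
    rwa [add_sub_cancel_right] at this
  · rintro z _ ⟨f, hf, rfl⟩
    have key : ∀ u, ((AddMonoidAlgebra.single (-Pi.single i 1) 1 : Lau K n) * f).coeff u =
        f.coeff (u + Pi.single i 1) := by
      intro u
      rw [AddMonoidAlgebra.coeff_single_mul_apply, one_mul, neg_neg, add_comm]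
    refine ⟨(supS K U hU).mkQ ((AddMonoidAlgebra.single (-Pi.single i 1) 1 : Lau K n) * f),
      ⟨_, ?_, rfl⟩, ?_⟩
    · intro u hu
      rw [key] at hu
      have h := hf _ hu
      refine ⟨?_, ?_⟩
      · have := h2 _ h.1
        rwa [add_sub_cancel_right] at this
      · have h3 : ∑ k, (u + Pi.single i 1 : Fin n → ℤ) k = z + 1 := h.2
        simp only [Pi.add_apply, Finset.sum_add_distrib, Finset.sum_pi_single', Finset.mem_univ,
          if_true] at h3
        show ∑ k, u k = z
        linarith
    · show (X i : PolyS K n) • (supS K U hU).mkQ _ = (supS K U hU).mkQ f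
      rw [← map_smul]
      congr 1
      apply AddMonoidAlgebra.coeff_injective
      ext u
      rw [coeff_X_smul, key, sub_add_cancel]

/-! ### Part 5: the Čech-type filtration -/

def Yk (n k : ℕ) : Set (Fin n → ℤ) := {u | ∃ j : Fin n, (j : ℕ) < k ∧ 0 ≤ u j}
def Xk (n k : ℕ) : Set (Fin n → ℤ) := {u | ∀ j : Fin n, k ≤ (j : ℕ) → 0 ≤ u j}

theorem Yk_up (k : ℕ) : UpS (Yk n k) := by
  rintro u v ⟨j, hj, h⟩
  refine ⟨j, hj, ?_⟩
  simp only [Pi.sub_apply, emb_apply] at h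
  omega

theorem Xk_up (k : ℕ) : UpS (Xk n k) := by
  intro u v h j hj
  have := h j hj
  simp only [Pi.sub_apply, emb_apply] at this
  omega

/-- The local cohomology modules of the initial segments of variables. -/
def Nk (K : Type) [Field K] (n k : ℕ) : GM K n := Reg K (Yk n k) (Xk n k) (Yk_up k) (Xk_up k)
/-- Their localisations. -/
def Wk (K : Type) [Field K] (n k : ℕ) : GM K n :=
  Reg K (Yk n k) (Xk n (k+1)) (Yk_up k) (Xk_up (k+1))

def NkSes (K : Type) [Field K] (n k : ℕ) (hk : k < n) : MSes (Nk K n k) (Wk K n k) (Nk K n (k+1)) := by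
  refine RegSes (Yk_up k) (Yk_up (k+1)) (Xk_up k) (Xk_up (k+1)) ?_ ?_ ?_ ?_
  · rintro u ⟨j, hj, h⟩; exact ⟨j, by omega, h⟩
  · intro u h j hj; exact h j (by omega)
  · intro u h; exact ⟨⟨k, hk⟩, by simp, h _ (by simp)⟩
  · rintro u ⟨h, j, hj, hu⟩
    rcases Nat.lt_succ_iff_lt_or_eq.1 hj with h1 | h1
    · exact Or.inr ⟨j, h1, hu⟩
    · left
      intro i hi
      rcases Nat.eq_or_lt_of_le hi with h2 | h2
      · have : i = j := Fin.ext (by omega)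
        rwa [this]
      · exact h i h2

theorem Wk_bij (F : FreeComplex K n) (k : ℕ) (hk : k < n) : (Ct F (Wk K n k)).Bij ⟨k, hk⟩ := by
  classical
  apply Reg_bij
  · rintro u ⟨j, hj, h⟩
    refine ⟨j, hj, ?_⟩
    rw [Pi.sub_apply, Pi.single_eq_of_ne (by intro h; rw [h] at hj; simp at hj)]
    simpa using h
  · intro u h j hj
    rw [Pi.sub_apply, Pi.single_eq_of_ne (by intro h; rw [h] at hj; simp at hj)]
    simpa using h j hj

/-- The polynomial ring as graded module. -/
def GMS (K : Type) [Field K] (n : ℕ) : GM K n where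
  N := PolyS K n
  gr := homogZ K n
  smul_mem := by
    intro j z s f hs hf
    apply mem_homogZ_of
    intro v hv
    rw [smul_eq_mul, MvPolynomial.coeff_mul] at hv
    obtain ⟨⟨a, b⟩, hab, h⟩ := Finset.exists_ne_zero_of_sum_ne_zero hv
    rw [Finset.HasAntidiagonal.mem_antidiagonal] at hab
    have h1 := homogZ_coeff hs (left_ne_zero_of_mul h)
    have h2 := homogZ_coeff hf (right_ne_zero_of_mul h)
    rw [← h1, ← h2, ← hab, ← Finset.sum_add_distrib]
    exact Finset.sum_congr rfl fun i _ => by simp [add_comm]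

theorem coeff_toL (s : PolyS K n) (v : Fin n →₀ ℕ) : (toL K n s).coeff (emb n v) = MvPolynomial.coeff v s := by
  have h := coeff_smul_L s (1 : Lau K n) (emb n v)
  rw [lau_smul, mul_one] at h
  rw [h, Finset.sum_eq_single v]
  · rw [sub_self]
    simp [AddMonoidAlgebra.one_def]
  · intro w _ hw
    rw [AddMonoidAlgebra.one_def, AddMonoidAlgebra.coeff_single, Finsupp.single_apply, if_neg, mul_zero]
    intro h0
    exact hw (emb_inj (sub_eq_zero.1 h0.symm)).symm
  · intro hv
    rw [notMem_support_iff.1 hv, zero_mul]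

theorem exists_emb {u : Fin n → ℤ} (h : ∀ i, 0 ≤ u i) : ∃ v, emb n v = u := by
  refine ⟨Finsupp.equivFunOnFinite.symm fun i => (u i).toNat, ?_⟩
  funext i
  simp [emb_apply, h i]

theorem toL_coeff_ne {s : PolyS K n} {u : Fin n → ℤ} (h : (toL K n s).coeff u ≠ 0) : ∃ v, emb n v = u := by
  have h' : (s • (1 : Lau K n) : Lau K n).coeff u ≠ 0 := by rwa [lau_smul, mul_one]
  obtain ⟨v, _, hv⟩ := exists_of_smul_ne h'
  rw [AddMonoidAlgebra.one_def, AddMonoidAlgebra.coeff_single, Finsupp.single_apply] at hv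
  by_cases h0 : 0 = u - emb n v
  · exact ⟨v, (sub_eq_zero.1 h0.symm).symm⟩
  · rw [if_neg h0] at hv; exact absurd rfl hv

/-- inclusion of `S`. -/
def j0 (K : Type) [Field K] (n : ℕ) : PolyS K n →ₗ[PolyS K n] (Lau K n ⧸ supS K (Yk n 0) (Yk_up 0)) :=
  (supS K (Yk n 0) (Yk_up 0)).mkQ ∘ₗ Algebra.linearMap (PolyS K n) (Lau K n)

theorem j0_apply (s : PolyS K n) : j0 K n s = (supS K (Yk n 0) (Yk_up 0)).mkQ (toL K n s) := rfl

theorem j0_inj (s : PolyS K n) (h : j0 K n s = 0) : s = 0 := by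
  rw [j0_apply, Submodule.mkQ_apply, Submodule.Quotient.mk_eq_zero] at h
  ext v
  rw [← coeff_toL]
  by_contra hne
  obtain ⟨j, hj, _⟩ := h _ hne
  omega

theorem j0_mem (z : ℤ) (s : PolyS K n) (hs : s ∈ homogZ K n z) : j0 K n s ∈ (Nk K n 0).gr z := by
  refine ⟨toL K n s, ?_, rfl⟩
  intro u hu
  obtain ⟨v, rfl⟩ := toL_coeff_ne hu
  rw [coeff_toL] at hu
  exact ⟨fun i _ => by simp [emb_apply], homogZ_coeff hs hu⟩

theorem j0_surj (z : ℤ) (w) (hw : w ∈ (Nk K n 0).gr z) : ∃ s ∈ homogZ K n z, j0 K n s = w := by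
  obtain ⟨f, hf, rfl⟩ := hw
  have hf0 : ∀ u ∈ f.coeff.support, ∃ v, emb n v = u := by
    intro u hu
    exact exists_emb fun i => (hf u (by simpa using hu)).1 i (by omega)
  choose! g hg using hf0
  let s : PolyS K n := ∑ u ∈ f.coeff.support, monomial (g u) (f.coeff u)
  have hs : toL K n s = f := by
    rw [map_sum]
    conv_rhs => rw [← AddMonoidAlgebra.sum_coeff_single f]
    refine Finset.sum_congr rfl fun u hu => ?_
    rw [toL_monomial, hg u hu]
  refine ⟨s, ?_, ?_⟩
  · apply mem_homogZ_of
    intro v hv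
    rw [← coeff_toL, hs] at hv
    exact (hf _ hv).2
  · rw [j0_apply, hs]; rfl

def SSes (K : Type) [Field K] (n : ℕ) (hn : 0 < n) : MSes (GMS K n) (Wk K n 0) (Nk K n 1) where
  j := (NkSes K n 0 hn).j ∘ₗ j0 K n
  π := (NkSes K n 0 hn).π
  j_mem := fun z v hv => (NkSes K n 0 hn).j_mem _ _ (j0_mem z v hv)
  π_mem := (NkSes K n 0 hn).π_mem
  inj := fun z v hv h => j0_inj v ((NkSes K n 0 hn).inj _ _ (j0_mem z v hv) h)
  πj := fun z v hv => (NkSes K n 0 hn).πj _ _ (j0_mem z v hv)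
  ex := by
    intro z v hv h
    obtain ⟨u, hu, rfl⟩ := (NkSes K n 0 hn).ex z v hv h
    obtain ⟨s, hs, rfl⟩ := j0_surj z u hu
    exact ⟨s, hs, rfl⟩
  surj := (NkSes K n 0 hn).surj

/-- All filtration steps. -/
def filAll (F : FreeComplex K n) (hn : 0 < n) : (k : ℕ) → k < n →
    Fil (List.finRange n) (Ct F (GMS K n)) k (Ct F (Nk K n (k + 1)))
  | 0, h => ((SSes K n hn).ct F).base _ ⟨0, hn⟩ (List.mem_finRange _) (Wk_bij F 0 hn)
  | k + 1, h => (filAll F hn k (by omega)).step ((NkSes K n (k+1) h).ct F) ⟨k + 1, h⟩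
      (List.mem_finRange _) (Wk_bij F (k+1) h)

/-! ### Part 6: residues and duality -/

/-- finite set of exponents of degree `j` -/
def expS (n : ℕ) (j : ℤ) : Finset (Fin n →₀ ℕ) := by
  classical exact Finset.finsuppAntidiag Finset.univ j.toNat

theorem mem_expS {j : ℤ} {v : Fin n →₀ ℕ} (h : ∑ i, (v i : ℤ) = j) : v ∈ expS n j := by
  classical
  unfold expS
  rw [Finset.mem_finsuppAntidiag]
  refine ⟨?_, Finset.subset_univ _⟩
  rw [← h, ← Nat.cast_sum, Int.toNat_natCast]

theorem homogZ_le_span (j : ℤ) : homogZ K n j ≤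
    Submodule.span K (Set.image (fun v => (monomial v (1 : K) : PolyS K n)) (↑(expS n j) : Set (Fin n →₀ ℕ))) := by
  classical
  intro s hs
  rw [s.as_sum]
  refine Submodule.sum_mem _ fun v hv => ?_
  have : monomial v (MvPolynomial.coeff v s) = MvPolynomial.coeff v s • monomial v (1 : K) := by
    rw [smul_monomial, smul_eq_mul, mul_one]
  rw [this]
  apply Submodule.smul_mem
  apply Submodule.subset_span
  exact ⟨v, mem_expS (homogZ_coeff hs (by simpa using hv)), rfl⟩

instance homogZ_fin (j : ℤ) : FiniteDimensional K (homogZ K n j) := by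
  have : FiniteDimensional K (Submodule.span K (Set.image (fun v => (monomial v (1 : K) : PolyS K n)) (↑(expS n j) : Set (Fin n →₀ ℕ)))) :=
    FiniteDimensional.span_of_finite K (((expS n j).finite_toSet).image _)
  exact Submodule.finiteDimensional_of_le (homogZ_le_span j)

instance freePiece_fin {r : ℕ} (dg : Fin r → ℤ) (ℓ : ℤ) :
    FiniteDimensional K (freePiece (K := K) (n := n) dg ℓ) := by
  let f : freePiece (K := K) (n := n) dg ℓ →ₗ[K] ((p : Fin r) → homogZ K n (ℓ - dg p)) :=
    { toFun := fun w p => ⟨w.1 p, w.2 p trivial⟩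
      map_add' := fun _ _ => rfl
      map_smul' := fun _ _ => rfl }
  apply FiniteDimensional.of_injective f
  intro u v h
  apply Subtype.ext
  funext p
  exact congrArg Subtype.val (congrFun h p)

theorem mem_freePiece {r : ℕ} {dg : Fin r → ℤ} {ℓ : ℤ} {w : Fin r → PolyS K n} :
    w ∈ freePiece dg ℓ ↔ ∀ p, w p ∈ homogZ K n (ℓ - dg p) := by
  simp [freePiece, Submodule.mem_pi]

/-- The residue. -/
def resD (K : Type) [Field K] (n : ℕ) : (Nk K n n).N →ₗ[K] K :=
  Submodule.liftQ ((supS K (Yk n n) (Yk_up n)).restrictScalars K)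
    (({ toFun := fun f => f.coeff (fun _ => -1)
        map_add' := fun _ _ => rfl
        map_smul' := fun _ _ => rfl } : Lau K n →ₗ[K] K)) (by
      intro f hf
      rw [LinearMap.mem_ker]
      by_contra h
      obtain ⟨j, _, hj⟩ := hf _ h
      have hj : (0 : ℤ) ≤ -1 := hj
      omega)

theorem resD_mk (f : Lau K n) : resD K n ((supS K (Yk n n) (Yk_up n)).mkQ f) = f.coeff (fun _ => -1) :=
  rfl

theorem resD_smul (s : PolyS K n) (f : Lau K n) :
    resD K n (s • ((supS K (Yk n n) (Yk_up n)).mkQ f : (Nk K n n).N)) = (s • f : Lau K n).coeff (fun _ => -1) :=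
  rfl

theorem res_P1 (z : ℤ) (v) (hv : v ∈ (Nk K n n).gr z)
    (h : ∀ s ∈ homogZ K n (-z - n), resD K n (s • v) = 0) : v = 0 := by
  obtain ⟨f, hf, rfl⟩ := hv
  show (supS K (Yk n n) (Yk_up n)).mkQ f = 0
  rw [Submodule.mkQ_apply, Submodule.Quotient.mk_eq_zero]
  intro u hu
  by_contra hY
  have hneg : ∀ j, u j < 0 := by
    intro j
    by_contra hj
    exact hY ⟨j, j.2, by omega⟩
  obtain ⟨w, hw⟩ := exists_emb (u := fun j => -1 - u j) (fun j => by have := hneg j; omega)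
  have hdeg : ∑ i, u i = z := (hf u hu).2
  have hw' : ∀ i, (w i : ℤ) = -1 - u i := fun i => congrFun hw i
  have := h (monomial w 1) (by
    apply mem_homogZ_of
    intro v hv
    rw [coeff_monomial] at hv
    split_ifs at hv with e
    · rw [← e]
      simp only [hw', Finset.sum_sub_distrib, hdeg]
      simp
      ring
    · exact absurd rfl hv)
  have h2 := (resD_smul (monomial w 1) f).symm.trans this
  rw [coeff_mono_smul, one_mul] at h2
  apply hu
  rw [← h2]
  congr 1
  funext i
  simp [emb_apply, hw']

theorem res_P2 (z : ℤ) (ℓ : PolyS K n →ₗ[K] K) : ∃ g ∈ (Nk K n n).gr z,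
    ∀ s ∈ homogZ K n (-z - n), resD K n (s • g) = ℓ s := by
  classical
  let g : Lau K n := ∑ v ∈ (expS n (-z - n)).filter (fun v => ∑ i, (v i : ℤ) = -z - n),
    AddMonoidAlgebra.single (fun i => -1 - (v i : ℤ)) (ℓ (monomial v 1))
  have hg : ∀ u, g.coeff u = ∑ v ∈ (expS n (-z - n)).filter (fun v => ∑ i, (v i : ℤ) = -z - n),
      if (fun i => -1 - (v i : ℤ)) = u then (ℓ (monomial v 1)) else 0 := by
    intro u
    simp only [g]
    rw [AddMonoidAlgebra.coeff_sum, Finsupp.finset_sum_apply]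
    exact Finset.sum_congr rfl fun v _ => by
      rw [AddMonoidAlgebra.coeff_single, Finsupp.single_apply]
  have hg2 : ∀ v : Fin n →₀ ℕ, ∑ i, (v i : ℤ) = -z - n →
      g.coeff (fun i => -1 - (v i : ℤ)) = ℓ (monomial v 1) := by
    intro v hv
    rw [hg, Finset.sum_eq_single v]
    · simp
    · intro w _ hw
      rw [if_neg]
      intro h
      apply hw
      ext i
      have := congrFun h i
      simp at this
      exact this
    · intro h
      exact absurd (Finset.mem_filter.2 ⟨mem_expS hv, hv⟩) h
  refine ⟨(supS K (Yk n n) (Yk_up n)).mkQ g, ⟨g, ?_, rfl⟩, ?_⟩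
  · intro u hu
    rw [hg] at hu
    obtain ⟨v, hv, h⟩ := Finset.exists_ne_zero_of_sum_ne_zero hu
    have hv := (Finset.mem_filter.1 hv).2
    by_cases e : (fun i => -1 - (v i : ℤ)) = u
    · refine ⟨fun j hj => absurd j.2 (by omega), ?_⟩
      show ∑ i, u i = z
      rw [← e]
      simp only [Finset.sum_sub_distrib, hv]
      simp
      ring
    · rw [if_neg e] at h; exact absurd rfl h
  · intro s hs
    refine (resD_smul s g).trans ?_
    rw [coeff_smul_L]
    conv_rhs => rw [s.as_sum, map_sum]
    refine Finset.sum_congr rfl fun v hv => ?_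
    have hd := homogZ_coeff hs (by simpa using hv)
    have e1 : ((fun _ => -1) - emb n v : Fin n → ℤ) = fun i => -1 - (v i : ℤ) := rfl
    rw [e1, hg2 v hd]
    have : monomial v (MvPolynomial.coeff v s) = MvPolynomial.coeff v s • monomial v (1 : K) := by
      rw [smul_monomial, smul_eq_mul, mul_one]
    rw [this, map_smul, smul_eq_mul]

/-- The dualising module. -/
abbrev DD (K : Type) [Field K] (n : ℕ) : GM K n := Nk K n n

/-- The pairing of `F_k` with `Hom(F_k, D)`. -/
def pr (F : FreeComplex K n) (k : ℕ) (v : (Ct F (DD K n)).V) : (Fin (F.rk k) → PolyS K n) →ₗ[K] K where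
  toFun w := ∑ p, resD K n (w p • v k p)
  map_add' := by intro u w; simp [add_smul, Finset.sum_add_distrib]
  map_smul' := by
    intro c w
    simp [Finset.mul_sum]

theorem pr_apply (F : FreeComplex K n) (k : ℕ) (v : (Ct F (DD K n)).V) (w) :
    pr F k v w = ∑ p, resD K n (w p • v k p) := rfl

theorem pr_adj (F : FreeComplex K n) (k : ℕ) (v : (Ct F (DD K n)).V) (w) :
    pr F k v ((F.dd k).mulVecLin w) = pr F (k+1) ((Ct F (DD K n)).d v) w := by
  rw [pr_apply, pr_apply]
  have h1 : ∀ p, resD K n ((F.dd k).mulVecLin w p • v k p) = ∑ p', resD K n ((F.dd k p p' * w p') • v k p) := by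
    intro p
    rw [Matrix.mulVecLin_apply, Matrix.mulVec, dotProduct, Finset.sum_smul, map_sum]
  have h2 : ∀ p', resD K n (w p' • (Ct F (DD K n)).d v (k+1) p') = ∑ p, resD K n ((F.dd k p p' * w p') • v k p) := by
    intro p'
    show resD K n (w p' • ∑ p, F.dd k p p' • v k p) = _
    rw [Finset.smul_sum, map_sum]
    refine Finset.sum_congr rfl fun p _ => ?_
    rw [smul_smul, mul_comm]
  simp only [h1, h2]
  exact Finset.sum_comm

theorem pr_P1 (F : FreeComplex K n) (k : ℕ) (d : ℤ) (v : (Ct F (DD K n)).V)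
    (hv : v ∈ (Ct F (DD K n)).gr k (-d - n))
    (h : ∀ w ∈ freePiece (F.deg k) d, pr F k v w = 0) : v = 0 := by
  classical
  funext k' p
  by_cases hk : (k' : ℤ) = k
  · have hk : k' = k := by exact_mod_cast hk
    subst hk
    refine res_P1 _ _ (hv k' p).1 fun s hs => ?_
    have hs' : s ∈ homogZ K n (d - F.deg k' p) := by
      rwa [show -(-d - (n : ℤ) + F.deg k' p) - n = d - F.deg k' p by ring] at hs
    have := h (Pi.single p s) (by
      rw [mem_freePiece]
      intro p'
      by_cases e : p' = p
      · subst e; simpa using hs'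
      · rw [Pi.single_eq_of_ne e]; exact zero_mem _)
    rw [pr_apply, Finset.sum_eq_single p] at this
    · rwa [Pi.single_eq_same] at this
    · intro p' _ e
      rw [Pi.single_eq_of_ne e, zero_smul, map_zero]
    · simp
  · exact (hv k' p).2 hk

theorem pr_P2 (F : FreeComplex K n) (k : ℕ) (d : ℤ) (ℓ : (Fin (F.rk k) → PolyS K n) →ₗ[K] K) :
    ∃ v ∈ (Ct F (DD K n)).gr k (-d - n), ∀ w ∈ freePiece (F.deg k) d, pr F k v w = ℓ w := by
  classical
  have h := fun p : Fin (F.rk k) => res_P2 (K := K) (n := n) (-d - n + F.deg k p) (ℓ ∘ₗ LinearMap.single K (fun _ : Fin (F.rk k) => PolyS K n) p)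
  choose g hg e using h
  refine ⟨fun k' p => if h : k' = k then g (h ▸ p) else 0, ?_, ?_⟩
  · intro k' p
    by_cases hk : k' = k
    · subst hk
      simp only [dif_pos]
      exact ⟨hg p, fun h => absurd rfl h⟩
    · simp only [dif_neg hk]
      exact ⟨zero_mem _, fun _ => trivial⟩
  · intro w hw
    rw [mem_freePiece] at hw
    refine (pr_apply F k _ w).trans ?_
    simp only [dif_pos]
    have : w = ∑ p, Pi.single p (w p) := (Finset.univ_sum_single w).symm
    conv_rhs => rw [this, map_sum]
    refine Finset.sum_congr rfl fun p _ => ?_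
    refine e p (w p) ?_
    have := hw p
    rwa [show d - F.deg k p = -(-d - (n : ℤ) + F.deg k p) - n by ring] at this

theorem dd_freePiece (F : FreeComplex K n) (k : ℕ) (d : ℤ) (w) (hw : w ∈ freePiece (F.deg (k+1)) d) :
    (F.dd k).mulVecLin w ∈ freePiece (F.deg k) d := by
  rw [mem_freePiece] at *
  intro p
  rw [Matrix.mulVecLin_apply, Matrix.mulVec, dotProduct]
  refine Submodule.sum_mem _ fun p' _ => ?_
  have := (GMS K n).smul_mem _ _ _ _ (F.isHomog k p p') (hw p')
  rw [show d - F.deg (k + 1) p' + (F.deg (k + 1) p' - F.deg k p) = d - F.deg k p by ring] at this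
  exact this

theorem factor_dual {V W : Type*} [AddCommGroup V] [Module K V] [AddCommGroup W] [Module K W]
    (f : V →ₗ[K] W) (ℓ : V →ₗ[K] K) (h : ∀ v, f v = 0 → ℓ v = 0) : ∃ g : W →ₗ[K] K, ∀ v, g (f v) = ℓ v := by
  have := LinearMap.range_dualMap_eq_dualAnnihilator_ker f
  have h2 : ℓ ∈ LinearMap.range f.dualMap := by
    rw [this, Submodule.mem_dualAnnihilator]
    exact fun w hw => h w hw
  obtain ⟨g, rfl⟩ := h2
  exact ⟨g, fun v => rfl⟩

/-- `Hom(F, D)` is exact in positive positions. -/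
theorem CtD_ex (F : FreeComplex K n) (hF : IsResolution F) (k : ℕ) (b : ℤ) :
    (Ct F (DD K n)).Ex ((k + 1 : ℕ) : ℤ) b := by
  obtain ⟨d, rfl⟩ : ∃ d : ℤ, b = -d - n := ⟨-b - n, by ring⟩
  intro v hv hdv
  obtain ⟨g, hg⟩ := factor_dual ((F.dd k).mulVecLin.restrictScalars K) (pr F (k+1) v) (by
    intro w hw
    have hw : w ∈ LinearMap.ker (F.dd k).mulVecLin := hw
    rw [hF k] at hw
    obtain ⟨w', rfl⟩ := hw
    rw [pr_adj, hdv, pr_apply]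
    exact Finset.sum_eq_zero fun p _ => by
      show resD K n (w' p • 0) = 0
      simp)
  obtain ⟨u, hu, e⟩ := pr_P2 F k d g
  refine ⟨u, by simpa using hu, ?_⟩
  rw [← sub_eq_zero]
  have hdu := (Ct F (DD K n)).d_mem _ _ _ hu
  apply pr_P1 F (k+1) d _ (sub_mem (by exact_mod_cast hdu) hv)
  intro w hw
  have h1 : pr F (k+1) ((Ct F (DD K n)).d u) w = pr F (k+1) v w := by
    rw [← pr_adj, e _ (dd_freePiece F k d w hw)]
    exact hg w
  have h2 : pr F (k+1) ((Ct F (DD K n)).d u - v) w = pr F (k+1) ((Ct F (DD K n)).d u) w - pr F (k+1) v w := by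
    simp only [pr_apply]
    rw [← Finset.sum_sub_distrib]
    refine Finset.sum_congr rfl fun p _ => ?_
    rw [← map_sub, ← smul_sub]
    rfl
  rw [h2, h1, sub_self]

/-- The cocycles in position zero. -/
def ZD (F : FreeComplex K n) (b : ℤ) : Submodule K (Ct F (DD K n)).V :=
  (Ct F (DD K n)).gr 0 b ⊓ LinearMap.ker (Ct F (DD K n)).d

/-- abbreviation for the denominator in `MPieceDim`. -/
def MI (F : FreeComplex K n) (d : ℤ) : Submodule K (freePiece (K := K) (n := n) (F.deg 0) d) :=
  Submodule.comap (freePiece (F.deg 0) d).subtype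
      ((LinearMap.range ((F.dd 0).mulVecLin)).restrictScalars K)

def prL (F : FreeComplex K n) : (Ct F (DD K n)).V →ₗ[K] ((Fin (F.rk 0) → PolyS K n) →ₗ[K] K) where
  toFun := pr F 0
  map_add' := by
    intro u v; refine LinearMap.ext fun w => ?_; simp only [pr_apply, LinearMap.add_apply]
    rw [← Finset.sum_add_distrib]
    refine Finset.sum_congr rfl fun p _ => ?_
    rw [← map_add, ← smul_add]; rfl
  map_smul' := by
    intro c v; refine LinearMap.ext fun w => ?_; simp only [pr_apply, LinearMap.smul_apply, RingHom.id_apply]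
    rw [Finset.smul_sum]
    refine Finset.sum_congr rfl fun p _ => ?_
    rw [← map_smul, ← smul_algebra_smul_comm c (w p) (v 0 p)]; rfl

theorem ZD_equiv (F : FreeComplex K n) (d : ℤ) :
    Nonempty (ZD F (-d - n) ≃ₗ[K] Dual K (freePiece (K := K) (n := n) (F.deg 0) d ⧸ MI F d)) := by
  let f : ZD F (-d - n) →ₗ[K] Dual K (freePiece (K := K) (n := n) (F.deg 0) d ⧸ MI F d) :=
    { toFun := fun v => (MI F d).liftQ (prL F v.1 ∘ₗ (freePiece (F.deg 0) d).subtype) (by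
        rintro ⟨w, hw⟩ ⟨w', hw'⟩
        have hw' : (F.dd 0).mulVecLin w' = w := hw'
        rw [LinearMap.mem_ker]
        show pr F 0 v.1 w = 0
        rw [← hw', pr_adj, pr_apply]
        have : (Ct F (DD K n)).d v.1 = 0 := v.2.2
        rw [this]
        exact Finset.sum_eq_zero fun p _ => by
          show resD K n (w' p • 0) = 0
          simp)
      map_add' := by
        intro u v
        refine Submodule.linearMap_qext _ ?_
        ext1 w
        show prL F (u.1 + v.1) w.1 = prL F u.1 w.1 + prL F v.1 w.1
        rw [map_add]; rfl
      map_smul' := by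
        intro c v
        refine Submodule.linearMap_qext _ ?_
        ext1 w
        show prL F (c • v.1) w.1 = c • prL F v.1 w.1
        rw [map_smul]; rfl }
  have hf : ∀ v w, f v ((MI F d).mkQ w) = pr F 0 v.1 w.1 := fun v w => rfl
  refine ⟨LinearEquiv.ofBijective f ⟨?_, ?_⟩⟩
  · rw [← LinearMap.ker_eq_bot, LinearMap.ker_eq_bot']
    intro v hv
    apply Subtype.ext
    apply pr_P1 F 0 d v.1 v.2.1
    intro w hw
    rw [← hf v ⟨w, hw⟩, hv]; rfl
  · intro φ
    obtain ⟨ℓ, hℓ⟩ := factor_dual (freePiece (K := K) (n := n) (F.deg 0) d).subtype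
      (φ ∘ₗ (MI F d).mkQ) (by
        intro v hv
        have : v = 0 := Subtype.ext hv
        rw [this, map_zero])
    obtain ⟨v, hv, e⟩ := pr_P2 F 0 d ℓ
    have hdv : (Ct F (DD K n)).d v = 0 := by
      apply pr_P1 F 1 d _ (by simpa using (Ct F (DD K n)).d_mem _ _ _ hv)
      intro w hw
      have h0 := dd_freePiece F 0 d w hw
      rw [← pr_adj, e _ h0]
      have := hℓ ⟨_, h0⟩
      refine this.trans ?_
      rw [LinearMap.comp_apply]
      have : (MI F d).mkQ ⟨_, h0⟩ = 0 := by
        rw [Submodule.mkQ_apply, Submodule.Quotient.mk_eq_zero]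
        exact ⟨w, rfl⟩
      rw [this, map_zero]
    refine ⟨⟨v, hv, hdv⟩, ?_⟩
    refine Submodule.linearMap_qext _ ?_
    ext1 w
    rw [LinearMap.comp_apply, hf, e _ w.2]
    exact hℓ w

theorem finrank_ZD (F : FreeComplex K n) (d : ℤ) : finrank K (ZD F (-d - n)) = MPieceDim F d := by
  obtain ⟨e⟩ := ZD_equiv F d
  exact e.finrank_eq.trans Subspace.dual_finrank_eq

theorem finite_ZD (F : FreeComplex K n) (d : ℤ) : FiniteDimensional K (ZD F (-d - n)) := by
  obtain ⟨e⟩ := ZD_equiv F d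
  exact Module.Finite.equiv e.symm

/-! ### Part 7: comparison of exactness -/

section Abs
variable {l : List (Fin n)} {C A : GC K n} {s : ℕ}

theorem Fil.T_of_C (f : Fil l C s A) (q b : ℤ) (hC : C.Ex q b)
    (h : ∀ t ∈ f.T.gr q b, f.T.d t = 0 → ∃ c ∈ A.gr (q - 1 - s) b, f.p t = ((-1 : K) ^ s) • A.d c) :
    f.T.Ex q b := by
  intro t ht hdt
  obtain ⟨c, hc, e⟩ := h t ht hdt
  obtain ⟨a, ha, t', ht', c', hc', e1, e2, e3⟩ := f.tot q b 0 (zero_mem _) t ht c hc (map_zero _)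
    (by rw [map_zero, hdt]) e
  obtain ⟨u, hu, rfl⟩ := hC a ha e1
  refine ⟨f.ι u + t', add_mem (f.ι_mem _ _ _ hu) ht', ?_⟩
  rw [e2, map_add, f.ι_d _ _ _ hu]

theorem Fil.C_of_T (f : Fil l C s A) (q b : ℤ) (hT : f.T.Ex q b)
    (h : ∀ v ∈ A.gr (q - 1 - s) b, v = 0) : C.Ex q b := by
  intro v hv hdv
  obtain ⟨t, ht, e⟩ := hT (f.ι v) (f.ι_mem _ _ _ hv) (by rw [← f.ι_d _ _ _ hv, hdv, map_zero])
  have hp : f.p t = 0 := h _ (f.p_mem _ _ _ ht)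
  obtain ⟨a, ha, t', ht', c', hc', e1, e2, e3⟩ := f.tot (q - 1) b v (by simpa using hv) t ht 0 (zero_mem _) hdv
    e.symm (by rw [hp, map_zero, smul_zero])
  exact ⟨a, ha, e1⟩

/-- cycles -/
def GC.Z (X : GC K n) (q b : ℤ) : Submodule K X.V := X.gr q b ⊓ LinearMap.ker X.d
/-- boundaries -/
def GC.B (X : GC K n) (q b : ℤ) : Submodule K X.V := (X.gr (q - 1) b).map X.d
/-- cohomology -/
abbrev GC.H (X : GC K n) (q b : ℤ) : Type := X.Z q b ⧸ (X.B q b).comap (X.Z q b).subtype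

theorem GC.mk_eq_zero {X : GC K n} {q b : ℤ} (z : X.Z q b) :
    ((X.B q b).comap (X.Z q b).subtype).mkQ z = 0 ↔ ∃ u ∈ X.gr (q - 1) b, X.d u = z.1 := by
  rw [Submodule.mkQ_apply, Submodule.Quotient.mk_eq_zero]
  rfl

theorem exists_linear_of_rel {Z Q : Type*} [AddCommGroup Z] [Module K Z] [AddCommGroup Q] [Module K Q]
    (G : Submodule K (Z × Q)) (ex : ∀ c, ∃ y, (c, y) ∈ G) (un : ∀ y, ((0 : Z), y) ∈ G → y = 0) :
    ∃ φ : Z →ₗ[K] Q, ∀ c y, (c, y) ∈ G ↔ φ c = y := by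
  choose g hg using ex
  have key : ∀ c y, (c, y) ∈ G → g c = y := by
    intro c y h
    have := G.sub_mem (hg c) h
    rw [Prod.mk_sub_mk, sub_self] at this
    exact sub_eq_zero.1 (un _ this)
  refine ⟨⟨⟨g, fun x y => key _ _ (G.add_mem (hg x) (hg y))⟩, fun c x => key _ _ (G.smul_mem c (hg x))⟩, ?_⟩
  intro c y
  exact ⟨key c y, fun h => h ▸ hg c⟩

/-- The connecting relation. -/
def Fil.G (f : Fil l C s A) (b : ℤ) : Submodule K (A.Z 0 b × C.H (s + 1) b) where
  carrier := {cy | ∃ z : C.Z (s + 1) b, ∃ t ∈ f.T.gr s b, ((C.B (s + 1) b).comap (C.Z (s + 1) b).subtype).mkQ z = cy.2 ∧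
    f.T.d t = f.ι z.1 ∧ f.p t = cy.1.1}
  add_mem' := by
    rintro ⟨c, y⟩ ⟨c', y'⟩ ⟨z, t, ht, h1, h2, h3⟩ ⟨z', t', ht', h1', h2', h3'⟩
    refine ⟨z + z', t + t', add_mem ht ht', ?_, ?_, ?_⟩
    · rw [map_add, h1, h1']; rfl
    · rw [map_add, h2, h2', Submodule.coe_add, map_add]
    · rw [map_add, h3, h3']; rfl
  zero_mem' := ⟨0, 0, zero_mem _, map_zero _, by simp, by simp⟩
  smul_mem' := by
    rintro a ⟨c, y⟩ ⟨z, t, ht, h1, h2, h3⟩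
    refine ⟨a • z, a • t, Submodule.smul_mem _ _ ht, ?_, ?_, ?_⟩
    · rw [map_smul, h1]; rfl
    · rw [map_smul, h2, Submodule.coe_smul, map_smul]
    · rw [map_smul, h3]; rfl

theorem neg_one_smul_eq_zero {V : Type*} [AddCommGroup V] [Module K V] (s : ℕ) (v : V)
    (h : ((-1 : K) ^ s) • v = 0) : v = 0 := by
  rcases smul_eq_zero.1 h with h | h
  · exact absurd h (pow_ne_zero _ (by simp))
  · exact h

theorem Fil.phi (f : Fil l C s A) (b : ℤ) (hA : ∀ q < 0, ∀ v ∈ A.gr q b, v = 0)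
    (hT : f.T.Ex (s + 1) b) :
    ∃ φ : A.Z 0 b →ₗ[K] C.H (s + 1) b, Function.Surjective φ ∧
      (f.T.Ex s b ↔ C.Ex s b ∧ Function.Injective φ) := by
  obtain ⟨φ, hφ⟩ := exists_linear_of_rel (f.G b) (by
    rintro ⟨c, hc, hdc⟩
    have hdc : A.d c = 0 := hdc
    obtain ⟨t, ht, e⟩ := f.surj s b c (by simpa using hc)
    obtain ⟨a, ha, t', ht', c', hc', e1, e2, e3⟩ := f.tot (s + 1) b 0 (zero_mem _) (f.T.d t)
      (f.T.d_mem _ _ _ ht) 0 (zero_mem _) (map_zero _) (by rw [map_zero, f.T.dd _ _ _ ht])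
      (by rw [f.p_d _ _ _ ht, e, hdc, map_zero])
    have hc0 : c' = 0 := hA _ (by omega) c' hc'
    rw [hc0, map_zero, smul_zero, add_zero] at e3
    refine ⟨_, ⟨a, ha, e1⟩, t - t', sub_mem ht (by simpa using ht'), rfl, ?_, ?_⟩
    · rw [map_sub, e2]; simp
    · rw [map_sub, e, ← e3, sub_zero]) (by
    rintro y ⟨z, t, ht, h1, h2, h3⟩
    have h3 : f.p t = 0 := h3
    obtain ⟨a, ha, t', ht', c', hc', e1, e2, e3⟩ := f.tot s b z.1 z.2.1 t ht 0 (zero_mem _) z.2.2 h2.symm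
      (by rw [h3, map_zero, smul_zero])
    refine h1.symm.trans ?_
    rw [GC.mk_eq_zero]
    exact ⟨a, by simpa using ha, e1⟩)
  refine ⟨φ, ?_, ?_, ?_⟩
  · intro y
    obtain ⟨z, rfl⟩ := Submodule.mkQ_surjective _ y
    have hdz : C.d z.1 = 0 := z.2.2
    obtain ⟨t, ht, e⟩ := hT (f.ι z.1) (f.ι_mem _ _ _ z.2.1) (by rw [← f.ι_d _ _ _ z.2.1, hdz, map_zero])
    have ht : t ∈ f.T.gr s b := by simpa using ht
    refine ⟨⟨f.p t, by simpa using f.p_mem _ _ _ ht, ?_⟩, ?_⟩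
    · show A.d (f.p t) = 0
      apply neg_one_smul_eq_zero (K := K) s
      rw [← f.p_d _ _ _ ht, e, f.pι _ _ _ z.2.1]
    · rw [← hφ]
      exact ⟨z, t, ht, rfl, e, rfl⟩
  · intro h
    refine ⟨f.C_of_T _ _ h (hA _ (by omega)), ?_⟩
    rw [← LinearMap.ker_eq_bot, LinearMap.ker_eq_bot']
    intro c hc
    obtain ⟨z, t, ht, h1, h2, h3⟩ := (hφ c 0).2 hc
    obtain ⟨u, hu, e⟩ := (GC.mk_eq_zero z).1 h1
    have hu : u ∈ C.gr s b := by simpa using hu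
    obtain ⟨t', ht', e'⟩ := h (t - f.ι u) (sub_mem ht (f.ι_mem _ _ _ hu)) (by
      rw [map_sub, h2, ← f.ι_d _ _ _ hu, e, sub_self])
    apply Subtype.ext
    have h3 : f.p t = c.1 := h3
    have h4 : f.p (t - f.ι u) = c.1 := by rw [map_sub, h3, f.pι _ _ _ hu, sub_zero]
    rw [← h4, ← e', f.p_d _ _ _ ht', hA _ (by omega) _ (f.p_mem _ _ _ ht'), map_zero, smul_zero]
    rfl
  · rintro ⟨hC, hi⟩
    apply f.T_of_C _ _ hC
    intro t ht hdt
    refine ⟨0, zero_mem _, ?_⟩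
    rw [map_zero, smul_zero]
    have hz : f.p t ∈ A.Z 0 b := by
      refine ⟨by simpa using f.p_mem _ _ _ ht, ?_⟩
      show A.d (f.p t) = 0
      apply neg_one_smul_eq_zero (K := K) s
      rw [← f.p_d _ _ _ ht, hdt, map_zero]
    have : φ ⟨f.p t, hz⟩ = 0 := by
      rw [← hφ]
      exact ⟨0, t, ht, map_zero _, by rw [hdt]; simp, rfl⟩
    have h0 : (⟨f.p t, hz⟩ : A.Z 0 b) = 0 := hi (this.trans (map_zero _).symm)
    exact congrArg Subtype.val h0

end Abs

/-! homogeneous components -/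

/-- homogeneous component in integer degree -/
def compZ (z : ℤ) : PolyS K n →ₗ[K] PolyS K n :=
  if 0 ≤ z then homogeneousComponent z.toNat else 0

theorem compZ_mem (z : ℤ) (f : PolyS K n) : compZ z f ∈ homogZ K n z := by
  unfold compZ
  split_ifs with h
  · lift z to ℕ using h
    rw [homogZ_nat, Int.toNat_natCast]
    exact homogeneousComponent_mem _ _
  · exact zero_mem _

theorem compZ_self {z : ℤ} {f : PolyS K n} (hf : f ∈ homogZ K n z) : compZ z f = f := by
  unfold compZ
  split_ifs with h
  · lift z to ℕ using h
    rw [homogZ_nat] at hf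
    rw [Int.toNat_natCast, homogeneousComponent_of_mem hf, if_pos rfl]
  · rw [homogZ_neg (by omega)] at hf
    rw [(Submodule.mem_bot K).1 hf]; rfl

theorem compZ_mul {z e : ℤ} {s : PolyS K n} (hs : s ∈ homogZ K n e) (f : PolyS K n) :
    compZ (z + e) (s * f) = s * compZ z f := by
  classical
  rcases lt_or_ge e 0 with he | he
  · rw [homogZ_neg he] at hs
    rw [(Submodule.mem_bot K).1 hs]; simp
  lift e to ℕ using he
  rw [homogZ_nat] at hs
  letI := gradedAlgebra (σ := Fin n) (R := K)
  have key : ∀ (g : PolyS K n) i, ((DirectSum.decompose (homogeneousSubmodule (Fin n) K) g i : homogeneousSubmodule (Fin n) K i) : PolyS K n) = homogeneousComponent i g := fun g i =>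
    decomposition.decompose'_apply g i
  unfold compZ
  rcases lt_or_ge z 0 with hz | hz
  · rw [if_neg (show ¬ 0 ≤ z by omega)]
    simp only [LinearMap.zero_apply, mul_zero]
    split_ifs with h
    · rw [← key]
      have hlt : ¬ e ≤ (z + (e : ℤ)).toNat := by omega
      exact DirectSum.coe_decompose_mul_of_left_mem_of_not_le _ hs hlt
    · rfl
  · lift z to ℕ using hz
    rw [if_pos (by omega), if_pos (by omega), Int.toNat_natCast, ← key, ← key,
      show ((z : ℤ) + e).toNat = e + z by omega]
    exact DirectSum.coe_decompose_mul_add_of_left_mem _ hs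

/-! ### Part 8: conclusion -/

/-- Placing a vector in position `k`. -/
def injC (F : FreeComplex K n) (k : ℕ) (w : Fin (F.rk k) → PolyS K n) : (Ct F (GMS K n)).V :=
  fun k' p => if h : k' = k then w (h ▸ p) else (0 : PolyS K n)

theorem injC_self (F : FreeComplex K n) (k : ℕ) (w) : injC F k w k = w := by
  funext p
  exact dif_pos rfl

theorem injC_ne (F : FreeComplex K n) {k k' : ℕ} (h : k' ≠ k) (w) : injC F k w k' = 0 := by
  funext p
  exact dif_neg h

theorem mem_fp_dual (F : FreeComplex K n) (k : ℕ) (b : ℤ) (w) :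
    w ∈ freePiece (K := K) (n := n) ((dualCo F).deg k) b ↔ ∀ p, w p ∈ homogZ K n (b + F.deg k p) := by
  rw [mem_freePiece]
  show (∀ p, w p ∈ homogZ K n (b - -F.deg k p)) ↔ _
  simp only [sub_neg_eq_add]

theorem injC_mem (F : FreeComplex K n) (k : ℕ) (b : ℤ) (w : Fin (F.rk k) → PolyS K n)
    (h : ∀ p, w p ∈ homogZ K n (b + F.deg k p)) : injC F k w ∈ (Ct F (GMS K n)).gr k b := by
  intro k' p
  by_cases e : k' = k
  · subst e
    rw [injC_self]
    exact ⟨h p, fun h => absurd rfl h⟩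
  · rw [injC_ne F e]
    exact ⟨zero_mem _, fun _ => rfl⟩

theorem gr_ext (F : FreeComplex K n) {N : GM K n} {k : ℕ} {b : ℤ} {u v : (Ct F N).V} (hu : u ∈ (Ct F N).gr k b)
    (hv : v ∈ (Ct F N).gr k b) (h : u k = v k) : u = v := by
  funext k' p
  by_cases e : k' = k
  · subst e; rw [h]
  · rw [(hu k' p).2 (by exact_mod_cast e), (hv k' p).2 (by exact_mod_cast e)]

theorem d_eq (F : FreeComplex K n) (k : ℕ) (v : (Ct F (GMS K n)).V) :
    (Ct F (GMS K n)).d v (k + 1) = ((dualCo F).dd k).mulVecLin (v k) := by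
  funext p'
  rfl

theorem kerPiece_iff (F : FreeComplex K n) (k : ℕ) (b : ℤ) (v : (Ct F (GMS K n)).V)
    (hv : v ∈ (Ct F (GMS K n)).gr k b) :
    (Ct F (GMS K n)).d v = 0 ↔ v k ∈ (dualCo F).kerPiece k b := by
  constructor
  · intro h
    refine ⟨?_, (mem_fp_dual F k b _).2 fun p => (hv k p).1⟩
    show ((dualCo F).dd k).mulVecLin (v k) = 0
    rw [← d_eq, h]; rfl
  · rintro ⟨h, _⟩
    have h : ((dualCo F).dd k).mulVecLin (v k) = 0 := h
    have h1 := (Ct F (GMS K n)).d_mem _ _ _ hv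
    refine gr_ext F (k := k + 1) (b := b) (by exact_mod_cast h1) (zero_mem _) ?_
    rw [d_eq, h]; rfl

theorem imSub_iff (F : FreeComplex K n) (k : ℕ) (b : ℤ) (v : (Ct F (GMS K n)).V)
    (hv : v ∈ (Ct F (GMS K n)).gr k b) :
    (∃ u ∈ (Ct F (GMS K n)).gr (k - 1) b, (Ct F (GMS K n)).d u = v) ↔ v k ∈ (dualCo F).imSub k := by
  cases k with
  | zero =>
    constructor
    · rintro ⟨u, _, rfl⟩
      exact (rfl : (0 : Fin (F.rk 0) → PolyS K n) = 0)
    · intro h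
      have h : v 0 = 0 := h
      exact ⟨0, zero_mem _, (map_zero _).trans (gr_ext F (k := 0) (zero_mem _) hv h.symm)⟩
  | succ k =>
    constructor
    · rintro ⟨u, _, rfl⟩
      exact ⟨u k, (d_eq F k u).symm⟩
    · rintro ⟨w, hw⟩
      have hw : ((dualCo F).dd k).mulVecLin w = v (k + 1) := hw
      have hm := injC_mem F k b (fun p => compZ (b + F.deg k p) (w p)) (fun p => compZ_mem _ _)
      refine ⟨_, by simpa using hm, ?_⟩
      refine gr_ext F (k := k + 1) (b := b) (by exact_mod_cast (Ct F (GMS K n)).d_mem _ _ _ hm) hv ?_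
      rw [d_eq, injC_self]
      funext p'
      have h1 := congrFun hw p'
      have h2 : v (k + 1) p' ∈ homogZ K n (b + F.deg (k + 1) p') := (hv (k+1) p').1
      rw [← h1] at h2 ⊢
      refine Eq.trans ?_ (compZ_self h2)
      show ∑ p : Fin (F.rk k), F.dd k p p' * compZ (b + F.deg k p) (w p) =
        compZ (b + F.deg (k + 1) p') (∑ p : Fin (F.rk k), F.dd k p p' * w p)
      rw [map_sum]
      refine Finset.sum_congr rfl fun p _ => ?_
      have h3 := compZ_mul (z := b + F.deg k p) (F.isHomog k p p') (w p)
      rw [show b + F.deg k p + (F.deg (k + 1) p' - F.deg k p) = b + F.deg (k+1) p' by ring] at h3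
      exact h3.symm

/-- evaluation of cycles -/
def evZ (F : FreeComplex K n) (k : ℕ) (b : ℤ) :
    (Ct F (GMS K n)).Z k b ≃ₗ[K] (dualCo F).kerPiece k b :=
  LinearEquiv.ofBijective
    { toFun := fun v => ⟨v.1 k, (kerPiece_iff F k b v.1 v.2.1).1 v.2.2⟩
      map_add' := fun _ _ => rfl
      map_smul' := fun _ _ => rfl }
    ⟨by
      intro u v h
      exact Subtype.ext (gr_ext F u.2.1 v.2.1 (congrArg Subtype.val h)), by
      rintro ⟨w, hw⟩
      have hm := injC_mem F k b w ((mem_fp_dual F k b _).1 hw.2)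
      refine ⟨⟨injC F k w, hm, (kerPiece_iff F k b _ hm).2 (by
        have e := injC_self F k w
        exact e.symm ▸ hw)⟩, ?_⟩
      exact Subtype.ext (injC_self F k w)⟩

theorem evZ_apply (F : FreeComplex K n) (k : ℕ) (b : ℤ) (v) : (evZ F k b v).1 = v.1 k := rfl

theorem H_equiv (F : FreeComplex K n) (k : ℕ) (b : ℤ) :
    Nonempty ((Ct F (GMS K n)).H k b ≃ₗ[K] ((dualCo F).kerPiece k b) ⧸
    (Submodule.comap ((dualCo F).kerPiece k b).subtype ((dualCo F).imSub k))) := by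
  refine ⟨Submodule.Quotient.equiv _ _ (evZ F k b) ?_⟩
  ext w
  obtain ⟨v, rfl⟩ := (evZ F k b).surjective w
  refine Iff.trans ?_ (imSub_iff F k b v.1 v.2.1)
  constructor
  · rintro ⟨v', hv', e⟩
    have e := (evZ F k b).injective e
    subst e
    exact hv'
  · intro h
    exact ⟨v, h, rfl⟩

instance kerPiece_fin (F : FreeComplex K n) (k : ℕ) (b : ℤ) : FiniteDimensional K ((dualCo F).kerPiece k b) :=
  Submodule.finiteDimensional_of_le (S₂ := freePiece (K := K) (n := n) ((dualCo F).deg k) b) inf_le_right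

theorem H_fin (F : FreeComplex K n) (k : ℕ) (b : ℤ) : FiniteDimensional K ((Ct F (GMS K n)).H k b) := by
  obtain ⟨e⟩ := H_equiv F k b
  exact Module.Finite.equiv e.symm

theorem finrank_H (F : FreeComplex K n) (k : ℕ) (b : ℤ) :
    finrank K ((Ct F (GMS K n)).H k b) = cohomDim (dualCo F) k b := by
  obtain ⟨e⟩ := H_equiv F k b
  exact e.finrank_eq

theorem cohomDim_zero_iff (F : FreeComplex K n) (k : ℕ) (b : ℤ) :
    cohomDim (dualCo F) k b = 0 ↔ (Ct F (GMS K n)).Ex k b := by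
  have := H_fin F k b
  rw [← finrank_H, finrank_zero_iff]
  constructor
  · intro h v hv hd
    exact (GC.mk_eq_zero (X := Ct F (GMS K n)) ⟨v, hv, hd⟩).1 (Subsingleton.elim _ _)
  · intro h
    refine subsingleton_of_forall_eq 0 fun y => ?_
    obtain ⟨z, rfl⟩ := Submodule.mkQ_surjective _ y
    exact (GC.mk_eq_zero z).2 (h z.1 z.2.1 z.2.2)

theorem Ct_gr_neg (F : FreeComplex K n) (N : GM K n) (b : ℤ) : ∀ q < 0, ∀ v ∈ (Ct F N).gr q b, v = 0 := by
  intro q hq v hv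
  funext k p
  exact (hv k p).2 (by omega)

theorem Ex_of_zero {X : GC K n} {q b : ℤ} (h : ∀ v ∈ X.gr q b, v = 0) : X.Ex q b := by
  intro v hv _
  exact ⟨0, zero_mem _, by rw [map_zero, h v hv]⟩

theorem extDim_zero_iff (F : FreeComplex K n) (q b : ℤ) :
    extDim F q b = 0 ↔ (Ct F (GMS K n)).Ex q b := by
  unfold extDim
  split_ifs with h
  · lift q to ℕ using h
    exact cohomDim_zero_iff F q b
  · exact ⟨fun _ => Ex_of_zero (Ct_gr_neg F _ b q (by omega)), fun _ => rfl⟩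

theorem deg_bound (F : FreeComplex K n) : ∃ B : ℤ, ∀ k p, F.deg k p < B ∧ -B < F.deg k p := by
  let S : Finset ℤ := (Finset.range (F.len + 1)).biUnion fun k => Finset.univ.image fun p => |F.deg k p|
  obtain ⟨B, hB⟩ := S.bddAbove
  refine ⟨B + 1, fun k p => ?_⟩
  have hk : k ∈ Finset.range (F.len + 1) := by
    rw [Finset.mem_range]
    by_contra h
    have := F.rk_eq_zero k (by omega)
    rw [this] at p
    exact p.elim0
  have : |F.deg k p| ≤ B := hB (by
    simp only [S, Finset.coe_biUnion, Set.mem_iUnion, Finset.coe_image]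
    exact ⟨k, hk, p, by simp, rfl⟩)
  have := abs_le.1 this
  omega

theorem CtS_zero (F : FreeComplex K n) : ∃ B : ℤ, ∀ b ≤ B, ∀ q, ∀ v ∈ (Ct F (GMS K n)).gr q b, v = 0 := by
  obtain ⟨B, hB⟩ := deg_bound F
  refine ⟨-B, fun b hb q v hv => ?_⟩
  funext k p
  have h1 : v k p ∈ homogZ K n (b + F.deg k p) := (hv k p).1
  rw [homogZ_neg (by have := hB k p; omega)] at h1
  exact (Submodule.mem_bot K).1 h1

theorem MPieceDim_zero (F : FreeComplex K n) : ∃ B : ℤ, ∀ d ≤ B, MPieceDim F d = 0 := by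
  obtain ⟨B, hB⟩ := deg_bound F
  refine ⟨-B, fun d hd => ?_⟩
  unfold MPieceDim
  have : Subsingleton (freePiece (K := K) (n := n) (F.deg 0) d) := by
    refine subsingleton_of_forall_eq 0 ?_
    rintro ⟨w, hw⟩
    apply Subtype.ext
    funext p
    have h1 := mem_freePiece.1 hw p
    rw [homogZ_neg (by have := hB 0 p; omega)] at h1
    exact (Submodule.mem_bot K).1 h1
  exact finrank_zero_of_subsingleton

section Main
variable {m : ℕ} (F : FreeComplex K (m + 1))

/-- the filtration -/
def FF : Fil (List.finRange (m + 1)) (Ct F (GMS K (m+1))) m (Ct F (DD K (m+1))) :=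
  filAll F (Nat.succ_pos m) m (Nat.lt_succ_self m)

theorem CtD_ex' (hF : IsResolution F) (q : ℤ) (hq : 1 ≤ q) (b : ℤ) : (Ct F (DD K (m+1))).Ex q b := by
  obtain ⟨k, rfl⟩ : ∃ k : ℕ, q = ((k + 1 : ℕ) : ℤ) := ⟨(q - 1).toNat, by omega⟩
  exact CtD_ex F hF k b

theorem F0 (hF : IsResolution F) (q : ℤ) (hq : (m : ℤ) + 1 ≤ q) (b : ℤ) : (FF F).T.Ex q b := by
  obtain ⟨B, hB⟩ := CtS_zero F
  have base : ∀ q, (m : ℤ) + 1 ≤ q → ∀ b ≤ B, (FF F).T.Ex q b := by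
    intro q hq b hb
    apply (FF F).T_of_C _ _ (Ex_of_zero (hB b hb q))
    intro t ht hdt
    have h0 : (Ct F (DD K (m+1))).d ((FF F).p t) = 0 := by
      apply neg_one_smul_eq_zero (K := K) m
      rw [← (FF F).p_d _ _ _ ht, hdt, map_zero]
    obtain ⟨c, hc, e⟩ := CtD_ex' F hF (q - m) (by omega) b _ ((FF F).p_mem _ _ _ ht) h0
    refine ⟨((-1 : K) ^ m) • c, Submodule.smul_mem _ _ ?_, ?_⟩
    · rwa [show q - m - 1 = q - 1 - (m : ℤ) by ring] at hc
    · rw [map_smul, smul_smul, e, ← mul_pow]; simp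
  have step : ∀ N : ℕ, ∀ q, (m : ℤ) + 1 ≤ q → (FF F).T.Ex q (B + N - q) := by
    intro N
    induction N with
    | zero => intro q hq; exact base q hq _ (by push_cast; omega)
    | succ N ih =>
      intro q hq
      have := lemmaC (List.finRange (m+1)) (FF F).T (B + N + 1) (m + 1) (FF F).kos (by
        intro q hq
        have := ih q hq
        rwa [show B + N + 1 - 1 - q = B + N - q by ring]) q hq
      rwa [show B + N + 1 - q = B + (N + 1 : ℕ) - q by push_cast; ring] at this
  rcases le_total b B with h | h
  · exact base q hq b h
  · have := step (b + q - B).toNat q hq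
    rwa [Int.toNat_of_nonneg (by omega), show B + (b + q - B) - q = b by ring] at this

theorem key_lt (q : ℤ) (hq : q < m) (b : ℤ) : (FF F).T.Ex q b ↔ (Ct F (GMS K (m+1))).Ex q b := by
  constructor
  · intro h
    exact (FF F).C_of_T _ _ h (Ct_gr_neg F _ b _ (by omega))
  · intro h
    refine (FF F).T_of_C _ _ h fun t ht _ => ⟨0, zero_mem _, ?_⟩
    rw [map_zero, smul_zero]
    exact Ct_gr_neg F _ b _ (by omega) _ ((FF F).p_mem _ _ _ ht)

theorem key_eq (hF : IsResolution F) (d : ℤ) :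
    (FF F).T.Ex m (-d - (m + 1 : ℕ)) ↔ extDim F m (-d - (m + 1 : ℕ)) = 0 ∧
      MPieceDim F d ≤ extDim F (m + 1 : ℕ) (-d - (m + 1 : ℕ)) := by
  obtain ⟨φ, hs, hi⟩ := (FF F).phi (-d - (m + 1 : ℕ)) (Ct_gr_neg F _ _) (F0 F hF _ le_rfl _)
  rw [hi, extDim_zero_iff]
  have e1 : finrank K ((Ct F (DD K (m+1))).Z 0 (-d - (m + 1 : ℕ))) = MPieceDim F d := finrank_ZD F d
  have e2 : finrank K ((Ct F (GMS K (m+1))).H (m + 1) (-d - (m + 1 : ℕ))) = extDim F (m + 1 : ℕ) (-d - (m + 1 : ℕ)) := by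
    unfold extDim
    rw [if_pos (by omega), Int.toNat_natCast]
    exact finrank_H F (m+1) _
  have f1 : FiniteDimensional K ((Ct F (DD K (m+1))).Z 0 (-d - (m + 1 : ℕ))) := finite_ZD F d
  have f2 : FiniteDimensional K ((Ct F (GMS K (m+1))).H (m + 1) (-d - (m + 1 : ℕ))) := H_fin F (m+1) _
  refine and_congr_right fun _ => ?_
  rw [← e1, ← e2]
  constructor
  · intro h
    exact LinearMap.finrank_le_finrank_of_injective h
  · intro h
    have h' := LinearMap.finrank_le_finrank_of_surjective hs
    exact (LinearMap.injective_iff_surjective_of_finrank_eq_finrank (le_antisymm h h')).2 hs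

theorem sheafH_zero_iff (hF : IsResolution F) (i : ℕ) (d : ℤ) :
    sheafH F i d = 0 ↔ (FF F).T.Ex (m - i) (-d - (m + 1 : ℕ)) := by
  unfold sheafH
  have e : ((m + 1 : ℕ) : ℤ) - 1 = m := by push_cast; ring
  split_ifs with h
  · subst h
    rw [e]
    have := key_eq F hF d
    simp only [Nat.cast_zero, sub_zero]
    rw [this]
    omega
  · rw [extDim_zero_iff, e, key_lt F _ (by omega)]

theorem sheafH_zero_iff' (hF : IsResolution F) (i : ℕ) (d : ℤ) :
    sheafH F i (d - i) = 0 ↔ (FF F).T.Ex (m - i) (-d - 1 - (m - i)) := by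
  rw [sheafH_zero_iff F hF]
  rw [show -(d - i) - ((m + 1 : ℕ) : ℤ) = -d - 1 - (m - i) by push_cast; ring]

/-- vanishing from `i0` on propagates upwards. -/
theorem van_up (hF : IsResolution F) (i0 : ℕ) (d : ℤ) (h : ∀ i, i0 ≤ i → sheafH F i (d - i) = 0) (N : ℕ) :
    ∀ i : ℕ, i0 ≤ i → sheafH F i (d + N - i) = 0 := by
  induction N with
  | zero => simpa using h
  | succ N ih =>
    intro i hi
    have := lemmaB (List.finRange (m+1)) (FF F).T (-(d + N) - 1) (m - i0) (FF F).kos (by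
      intro q hq
      have := (sheafH_zero_iff' F hF (m - q).toNat (d + N)).1 (ih _ (by omega))
      rwa [show (m : ℤ) - ((m - q).toNat : ℤ) = q by omega] at this) (m - i) (by omega)
    rw [sheafH_zero_iff' F hF]
    rwa [show -(d + N) - 1 - 1 - ((m : ℤ) - i) = -(d + (N + 1 : ℕ)) - 1 - (m - i) by push_cast; ring] at this

/-- vanishing up to `i0` propagates downwards. -/
theorem van_down (hF : IsResolution F) (i0 : ℕ) (d : ℤ) (h : ∀ i, i ≤ i0 → sheafH F i (d - i) = 0) (N : ℕ) :
    ∀ i : ℕ, i ≤ i0 → sheafH F i (d - N - i) = 0 := by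
  induction N with
  | zero => simpa using h
  | succ N ih =>
    intro i hi
    have := lemmaC (List.finRange (m+1)) (FF F).T (-(d - N) - 1 + 1) (m - i0) (FF F).kos (by
      intro q hq
      rcases le_or_gt ((m : ℤ) + 1) q with hq2 | hq2
      · exact F0 F hF _ hq2 _
      have := (sheafH_zero_iff' F hF (m - q).toNat (d - N)).1 (ih _ (by omega))
      rw [show (m : ℤ) - ((m - q).toNat : ℤ) = q by omega] at this
      rwa [show -(d - N) - 1 + 1 - 1 - q = -(d - N) - 1 - q by ring]) (m - i) (by omega)
    rw [sheafH_zero_iff' F hF]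
    rwa [show -(d - N) - 1 + 1 - ((m : ℤ) - i) = -(d - (N + 1 : ℕ)) - 1 - (m - i) by push_cast; ring] at this

theorem main_nonzero (hF : IsResolution F) (hnz : {ℓ : ℤ | MPieceDim F ℓ ≠ 0}.Infinite) (d : ℤ) :
    ∃ i : ℕ, sheafH F i (d - i) ≠ 0 := by
  by_contra hcon
  push Not at hcon
  apply hnz
  obtain ⟨B, hB⟩ := MPieceDim_zero F
  obtain ⟨B', hB'⟩ := CtS_zero F
  refine (Set.finite_Icc B (max d (-B'))).subset ?_
  intro e he
  have he : MPieceDim F e ≠ 0 := he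
  refine ⟨?_, ?_⟩
  · by_contra h
    exact he (hB e (by omega))
  · by_contra h
    have h1 : d < e := by omega
    have h2 : -B' < e := by omega
    have := van_up F hF 0 d (fun i _ => hcon i) (e - d).toNat 0 le_rfl
    rw [Int.toNat_of_nonneg (by omega), sheafH_zero_iff F hF] at this
    simp only [Nat.cast_zero, sub_zero] at this
    rw [show d + (e - d) = e by ring] at this
    have h3 := ((key_eq F hF e).1 this).2
    rw [(extDim_zero_iff F _ _).2 (Ex_of_zero (hB' _ (by omega) _))] at h3
    omega

end Main

theorem cohomology_table_columns_aux (K : Type) [Field K] (m : ℕ)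
    (F : FreeComplex K (m + 1)) (hres : IsResolution F)
    (hnz : {ℓ : ℤ | MPieceDim F ℓ ≠ 0}.Infinite) :
    (∀ d : ℤ, ∃ i : ℕ, sheafH F i (d - i) ≠ 0) ∧
    (∀ d d' : ℤ, d ≤ d' → ∀ i i' : ℕ,
      IsGreatest {i : ℕ | sheafH F i (d - i) ≠ 0} i →
      IsGreatest {i : ℕ | sheafH F i (d' - i) ≠ 0} i' → i' ≤ i) ∧
    (∀ d d' : ℤ, d ≤ d' → ∀ i i' : ℕ,
      IsLeast {i : ℕ | sheafH F i (d - i) ≠ 0} i →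
      IsLeast {i : ℕ | sheafH F i (d' - i) ≠ 0} i' → i' ≤ i) := by
  refine ⟨main_nonzero F hres hnz, ?_, ?_⟩
  · intro d d' hd i i' h h'
    by_contra hlt
    apply h'.1
    have := van_up F hres i' d (fun j hj => by
      by_contra hne
      have := h.2 hne
      omega) (d' - d).toNat i' le_rfl
    rwa [Int.toNat_of_nonneg (by omega), show d + (d' - d) = d' by ring] at this
  · intro d d' hd i i' h h'
    by_contra hlt
    apply h.1
    have := van_down F hres i d' (fun j hj => by
      by_contra hne
      have := h'.2 hne
      omega) (d' - d).toNat i le_rfl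
    rwa [Int.toNat_of_nonneg (by omega), show d' - (d' - d) = d by ring] at this

/-- If `𝓔` is a nonzero coherent sheaf on `ℙ^m` (the sheaf
associated to `M = coker (F₁ → F₀)`; it is nonzero iff `M` is not of finite
length), then for each `d` some `h^i(𝓔(d-i)) ≠ 0`; moreover
`M_d = max{i : h^i(𝓔(d-i)) ≠ 0}` and `m_d = min{i : h^i(𝓔(d-i)) ≠ 0}` are
weakly decreasing functions of `d`. -/
theorem cohomology_table_columns (K : Type) [Field K] (m : ℕ)
    (F : FreeComplex K (m + 1)) (hres : IsResolution F)
    (hnz : {ℓ : ℤ | MPieceDim F ℓ ≠ 0}.Infinite) :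
    (∀ d : ℤ, ∃ i : ℕ, sheafH F i (d - i) ≠ 0) ∧
    (∀ d d' : ℤ, d ≤ d' → ∀ i i' : ℕ,
      IsGreatest {i : ℕ | sheafH F i (d - i) ≠ 0} i →
      IsGreatest {i : ℕ | sheafH F i (d' - i) ≠ 0} i' → i' ≤ i) ∧
    (∀ d d' : ℤ, d ≤ d' → ∀ i i' : ℕ,
      IsLeast {i : ℕ | sheafH F i (d - i) ≠ 0} i →
      IsLeast {i : ℕ | sheafH F i (d' - i) ≠ 0} i' → i' ≤ i) := by
  exact cohomology_table_columns_aux K m F hres hnz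

end
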